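/- Let q be an odd prime power, d ≥ 2, and E ⊆ 𝔽_q^d. Then for k ≥ 1, C_{2k} = q^{−1}·C_k·C_{k−1} + R_{2k}, where |R_{2k}| ≤ 2·q^{(d−1)/2}·√(C_{2k}·C_{2k−2}). -/

import Mathlib

/-- `C_n`: the number of unit-distance chains of length `n` in `E ⊆ 𝔽_q^d`, i.e. tuples
`(x^1, …, x^{n+1}) ∈ E^{n+1}` with `‖x^i − x^{i+1}‖ = 1` for `1 ≤ i ≤ n`,
where `‖x‖ = x_1^2 + ⋯ + x_d^2`. -/
def chainCount {F : Type} [Field F] [Fintype F] [DecidableEq F] {d : ℕ}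
    (E : Finset (Fin d → F)) (n : ℕ) : ℕ :=
  (Finset.univ.filter (fun x : Fin (n + 1) → (Fin d → F) =>
    (∀ i, x i ∈ E) ∧ ∀ i : Fin n, ∑ j, (x i.castSucc j - x i.succ j) ^ 2 = 1)).card


open Polynomial in
/-- part of `P` with exponents congruent to `i` mod `B`, shifted down by `i` -/
noncomputable def redPart (K : Type) [Field K] (B i : ℕ) : K[X] →ₗ[K] K[X] :=
  Polynomial.lsum (fun n => if n % B = i then Polynomial.monomial (n - i) else 0)

open Polynomial in
lemma redPart_monomial {K : Type} [Field K] (B i n : ℕ) (c : K) :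
    redPart K B i (monomial n c) = if n % B = i then monomial (n - i) c else 0 := by
  unfold redPart
  rw [Polynomial.lsum_apply, Polynomial.sum_monomial_index]
  · split_ifs <;> simp
  · simp

open Polynomial in
lemma sum_redPart {K : Type} [Field K] (B : ℕ) (hB : 0 < B) (P : K[X]) :
    ∑ i ∈ Finset.range B, X ^ i * redPart K B i P = P := by
  induction P using Polynomial.induction_on' with
  | add p q hp hq =>
    simp only [map_add, mul_add, Finset.sum_add_distrib, hp, hq]
  | monomial n c =>
    simp only [redPart_monomial]
    rw [Finset.sum_eq_single (n % B)]
    · simp only [if_true, X_pow_mul_monomial]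
      rw [Nat.sub_add_cancel (Nat.mod_le _ _)]
    · intro b _ hb
      rw [if_neg (fun h => hb h.symm)]; simp
    · intro h
      exact absurd (Finset.mem_range.2 (Nat.mod_lt _ hB)) h

open Polynomial in
lemma redPart_mem_degreeLT {K : Type} [Field K] (B i D : ℕ) (P : K[X])
    (hP : P ∈ degreeLT K D) : redPart K B i P ∈ degreeLT K D := by
  classical
  rw [degreeLT_eq_span_X_pow] at hP
  induction hP using Submodule.span_induction with
  | mem x hx =>
    simp only [Finset.coe_image, Set.mem_image, Finset.coe_range, Set.mem_Iio] at hx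
    obtain ⟨n, hn, rfl⟩ := hx
    rw [← monomial_one_right_eq_X_pow, redPart_monomial]
    split_ifs
    · rw [mem_degreeLT]
      refine (degree_monomial_le _ _).trans_lt ?_
      exact_mod_cast (lt_of_le_of_lt (Nat.sub_le _ _) hn)
    · exact Submodule.zero_mem _
  | zero => simp
  | add x y _ _ hx hy => rw [map_add]; exact Submodule.add_mem _ hx hy
  | smul a x _ hx => rw [map_smul]; exact Submodule.smul_mem _ _ hx

open Polynomial in
lemma pow_sub_dvd {K : Type} [Field K] (p e : ℕ) [Fact p.Prime] [CharP K p] (f : K[X]) (x : K) :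
    (X - C x) ^ (p ^ e) ∣ f ^ (p ^ e) - C ((f.eval x) ^ (p ^ e)) := by
  rw [C_pow, ← sub_pow_char_pow]
  exact pow_dvd_pow_of_dvd (by rw [dvd_iff_isRoot]; simp) _

open Polynomial in
lemma redPart_dvd {K : Type} [Field K] (p e i : ℕ) [Fact p.Prime] [CharP K p] (P : K[X]) (x : K) :
    (X - C x) ^ (p ^ e) ∣ redPart K (p ^ e) i P - C ((redPart K (p ^ e) i P).eval x) := by
  induction P using Polynomial.induction_on' with
  | add p q hp hq =>
    have := dvd_add hp hq
    simp only [map_add, eval_add]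
    convert this using 1; ring
  | monomial n c =>
    rw [redPart_monomial]
    split_ifs with h
    · have h1 : n - i = p ^ e * (n / p ^ e) := by
        have := Nat.mod_add_div n (p ^ e)
        omega
      rw [h1, ← C_mul_X_pow_eq_monomial]
      simp only [eval_mul, eval_C, eval_pow, eval_X, C_mul]
      rw [← mul_sub]
      refine Dvd.dvd.mul_left ?_ _
      have h2 := pow_sub_dvd p e (X : K[X]) x
      rw [pow_mul, pow_mul, C_pow]
      refine h2.trans ?_
      simpa using sub_dvd_pow_sub_pow (X ^ p ^ e : K[X]) (C (x ^ p ^ e)) (n / p ^ e)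
    · simp

open Polynomial in
lemma stepanov_nonvanish {K : Type} [Field K] (p e : ℕ) [Fact p.Prime] [CharP K p]
    (hfrob : ∀ x : K, x ^ (p ^ e) = x) (hodd : Odd (p ^ e))
    (f : K[X]) (hf : Squarefree f) (hdeg : 0 < f.natDegree) (hf0 : f.eval 0 ≠ 0)
    (A : ℕ) (hA : 2 * A + f.natDegree ≤ p ^ e) (J : ℕ) :
    ∀ (r s : ℕ → K[X]), (∀ j, r j ∈ degreeLT K A) → (∀ j, s j ∈ degreeLT K A) →
    ∑ j ∈ Finset.range J, (r j + s j * f ^ ((p ^ e - 1) / 2)) * X ^ (j * p ^ e) = 0 →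
    ∀ j < J, r j = 0 ∧ s j = 0 := by
  have base : ∀ r s : K[X], r ∈ degreeLT K A → s ∈ degreeLT K A →
      X ^ (p ^ e) ∣ r + s * f ^ ((p ^ e - 1) / 2) → r = 0 ∧ s = 0 := by
    intro r s hr hs hd
    have hfne : f ≠ 0 := hf.ne_zero
    have h1 : X ^ (p ^ e) ∣ r ^ 2 * f - s ^ 2 * f ^ (p ^ e) := by
      have hpe : f ^ (p ^ e) = (f ^ ((p ^ e - 1) / 2)) ^ 2 * f := by
        rw [← pow_mul, ← pow_succ]; congr 1
        obtain ⟨t, ht⟩ := hodd; omega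
      rw [hpe]
      have : r ^ 2 * f - s ^ 2 * ((f ^ ((p ^ e - 1) / 2)) ^ 2 * f) =
        (r + s * f ^ ((p ^ e - 1) / 2)) * ((r - s * f ^ ((p ^ e - 1) / 2)) * f) := by ring
      rw [this]; exact Dvd.dvd.mul_right hd _
    have h2 : X ^ (p ^ e) ∣ f ^ (p ^ e) - C (f.eval 0) := by
      have := pow_sub_dvd p e f 0
      rwa [hfrob, C_0, sub_zero] at this
    have h3 : X ^ (p ^ e) ∣ r ^ 2 * f - s ^ 2 * C (f.eval 0) := by
      have := dvd_add h1 (Dvd.dvd.mul_left h2 (s ^ 2))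
      convert this using 1; ring
    rw [mem_degreeLT] at hr hs
    have h4 : r ^ 2 * f - s ^ 2 * C (f.eval 0) = 0 := by
      refine eq_zero_of_dvd_of_degree_lt h3 ?_
      rw [degree_X_pow]
      have key : ∀ t u : K[X], t.degree < A → u.natDegree ≤ f.natDegree →
          (t ^ 2 * u).degree < ((p ^ e : ℕ) : WithBot ℕ) := by
        intro t u ht hu
        by_cases ht0 : t = 0
        · subst ht0; rw [zero_pow two_ne_zero, zero_mul, degree_zero]; exact WithBot.bot_lt_coe _
        by_cases hu0 : u = 0
        · subst hu0; rw [mul_zero, degree_zero]; exact WithBot.bot_lt_coe _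
        rw [degree_eq_natDegree (mul_ne_zero (pow_ne_zero _ ht0) hu0),
          natDegree_mul (pow_ne_zero _ ht0) hu0, natDegree_pow]
        rw [degree_eq_natDegree ht0] at ht
        have : t.natDegree < A := by exact_mod_cast ht
        exact_mod_cast (by omega : 2 * t.natDegree + u.natDegree < p ^ e)
      refine (degree_sub_le _ _).trans_lt (max_lt (key _ _ hr le_rfl) (key _ _ hs ?_))
      simp
    have h5 : r ^ 2 * f = s ^ 2 * C (f.eval 0) := sub_eq_zero.1 h4
    have hCu : IsUnit (C (f.eval 0)) := isUnit_C.2 (isUnit_iff_ne_zero.2 hf0)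
    by_cases hr0 : r = 0
    · subst hr0
      have : s ^ 2 * C (f.eval 0) = 0 := by rw [← h5]; ring
      have := (mul_eq_zero.1 this).resolve_right hCu.ne_zero
      exact ⟨rfl, by simpa using this⟩
    · exfalso
      have h6 : r ^ 2 ∣ s ^ 2 := by
        have : r ^ 2 ∣ s ^ 2 * C (f.eval 0) := ⟨f, h5.symm⟩
        exact (hCu.dvd_mul_right).1 this
      have h7 : r ∣ s := (IsIntegrallyClosed.pow_dvd_pow_iff (by norm_num)).1 h6
      obtain ⟨t, rfl⟩ := h7
      have h8 : f = t * t * C (f.eval 0) := by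
        have : r ^ 2 * f = r ^ 2 * (t * t * C (f.eval 0)) := by rw [h5]; ring
        exact mul_left_cancel₀ (pow_ne_zero _ hr0) this
      have h9 : IsUnit t := hf t ⟨_, h8⟩
      have h10 : IsUnit f := by rw [h8]; exact (h9.mul h9).mul hCu
      have := natDegree_eq_zero_of_isUnit h10
      omega
  induction J with
  | zero => intro r s _ _ _ j hj; omega
  | succ J ih =>
    intro r s hr hs h
    rw [Finset.sum_range_succ'] at h
    have hfac : ∑ j ∈ Finset.range J, (r (j + 1) + s (j + 1) * f ^ ((p ^ e - 1) / 2)) *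
        X ^ ((j + 1) * p ^ e) = X ^ (p ^ e) * ∑ j ∈ Finset.range J,
        (r (j + 1) + s (j + 1) * f ^ ((p ^ e - 1) / 2)) * X ^ (j * p ^ e) := by
      rw [Finset.mul_sum]
      refine Finset.sum_congr rfl fun j _ => ?_
      rw [add_mul j, one_mul, pow_add]; ring
    rw [hfac, zero_mul, pow_zero, mul_one] at h
    have h0 := base (r 0) (s 0) (hr 0) (hs 0) (by
      rw [← neg_eq_of_add_eq_zero_right h]
      exact (Dvd.intro _ rfl).neg_right)
    rw [h0.1, h0.2, zero_mul, add_zero, add_zero] at h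
    have h' := (mul_eq_zero.1 h).resolve_left (pow_ne_zero _ X_ne_zero)
    have := ih (fun j => r (j + 1)) (fun j => s (j + 1)) (fun j => hr _) (fun j => hs _) h'
    intro j hj
    cases j with
    | zero => exact h0
    | succ j => exact this j (by omega)

lemma stepanov_arith1 (B h m A J : ℕ) (hh : B = 2 * h + 1) (hJ : J = h + m + 2) (hB : m + 3 ≤ B)
    (hA2 : B ^ 2 ≤ 2 * A + m + 1) : B * (A + m * h + J) < 2 * (J * A) := by
  have h1 : 2 * J = B + (2 * m + 3) := by omega
  have h2 : 2 * h ≤ B := by omega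
  have h3 : 2 * (B * (A + m * h + J)) ≤ B * (2 * A + m * B + B + (2 * m + 3)) := by
    calc 2 * (B * (A + m * h + J)) = B * (2 * A + m * (2 * h) + 2 * J) := by ring
      _ ≤ B * (2 * A + m * B + 2 * J) := by gcongr
      _ = _ := by rw [h1]; ring
  have h4 : 2 * (2 * (J * A)) = B * (2 * A) + (2 * m + 3) * (2 * A) := by
    calc 2 * (2 * (J * A)) = (2 * J) * (2 * A) := by ring
      _ = _ := by rw [h1]; ring
  have h5 : B * (m * B + B + (2 * m + 3)) < (2 * m + 3) * (2 * A) := by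
    have h6 : (2 * m + 3) * B ^ 2 ≤ (2 * m + 3) * (2 * A + m + 1) := Nat.mul_le_mul_left _ hA2
    have h7 : (m + 2) * ((m + 3) * B) ≤ (m + 2) * (B * B) := by gcongr
    have h8 : (2 * m + 3) * (m + 1) < (2 * m + 3) * B := by
      apply Nat.mul_lt_mul_of_pos_left <;> omega
    have h9 : 0 ≤ m * m * B := by positivity
    have h10 : 0 ≤ m * B := by positivity
    nlinarith
  have h11 : B * (2 * A + m * B + B + (2 * m + 3)) = B * (2 * A) + B * (m * B + B + (2 * m + 3)) := by
    ring
  omega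

lemma stepanov_arith2 (B h m A N : ℕ) (hh : B = 2 * h + 1)
    (hA1 : 2 * A + m ≤ B ^ 2)
    (hfin : N * B ≤ A + m * (B * h + h) + (h + m + 1) * B ^ 2) :
    (2 * N) * B ≤ (B ^ 2 + (3 * m + 3) * B) * B := by
  have h1 : 2 * (B * h + h) ≤ B ^ 2 := by rw [hh]; nlinarith
  have h3 : 2 * ((h + m + 1) * B ^ 2) + B ^ 2 = (B + 2 * m + 2) * B ^ 2 := by
    calc 2 * ((h + m + 1) * B ^ 2) + B ^ 2 = (2 * h + 1 + 2 * m + 2) * B ^ 2 := by ring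
      _ = _ := by rw [← hh]
  have h4 : m * (2 * (B * h + h)) ≤ m * B ^ 2 := Nat.mul_le_mul_left _ h1
  have h5 : (B ^ 2 + (3 * m + 3) * B) * B = (B + 2 * m + 2) * B ^ 2 + m * B ^ 2 + B ^ 2 := by ring
  have h6 : m * (2 * (B * h + h)) = 2 * (m * (B * h + h)) := by ring
  have h7 : 2 * N * B = 2 * (N * B) := by ring
  omega


open Polynomial in
lemma stepanov_linear {K : Type} [Field K] (f : K[X]) (B h A J M : ℕ) 
    (hM : A + f.natDegree * h + J ≤ M) (hdim : B * M < 2 * (J * A)) :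
    ∃ r s : ℕ → K[X], (∀ j, r j ∈ degreeLT K A) ∧ (∀ j, s j ∈ degreeLT K A) ∧
      (¬ ∀ j < J, r j = 0 ∧ s j = 0) ∧
      ∀ i < B, ∑ j ∈ Finset.range J, (f ^ h * redPart K B i (r j) -
        redPart K B i (s j * f ^ h)) * X ^ j = 0 := by
  classical
  let L : ((Fin J → degreeLT K A) × (Fin J → degreeLT K A)) →ₗ[K] (Fin B → K[X]) :=
    LinearMap.pi fun i =>
      ∑ j : Fin J, (LinearMap.mulRight K ((X : K[X]) ^ (j : ℕ))) ∘ₗ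
        ((LinearMap.mulLeft K (f ^ h)) ∘ₗ (redPart K B i) ∘ₗ (degreeLT K A).subtype ∘ₗ
          (LinearMap.proj j) ∘ₗ (LinearMap.fst K _ _) -
          (redPart K B i) ∘ₗ (LinearMap.mulRight K (f ^ h)) ∘ₗ (degreeLT K A).subtype ∘ₗ
          (LinearMap.proj j) ∘ₗ (LinearMap.snd K _ _))
  have hL : ∀ v i, L v i = ∑ j : Fin J, (f ^ h * redPart K B i (v.1 j : K[X]) -
        redPart K B i ((v.2 j : K[X]) * f ^ h)) * X ^ (j : ℕ) := by
    intro v i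
    simp [L, LinearMap.sum_apply]
  have hfd : (f ^ h).degree ≤ ((f.natDegree * h : ℕ) : WithBot ℕ) := by
    refine degree_le_natDegree.trans ?_
    exact_mod_cast (natDegree_pow_le).trans (by rw [mul_comm])
  have hmem : ∀ v i, L v i ∈ degreeLT K M := by
    intro v i
    rw [hL]
    refine Submodule.sum_mem _ fun j _ => ?_
    have mulmem : ∀ (a b : K[X]) (m n : ℕ), a ∈ degreeLT K m → b.degree ≤ (n : WithBot ℕ) →
        a * b ∈ degreeLT K (m + n) := by
      intro a b m n ha hb
      rw [mem_degreeLT] at ha ⊢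
      rw [degree_mul]
      by_cases hb0 : b = 0
      · rw [hb0, degree_zero, WithBot.add_bot]; exact WithBot.bot_lt_coe _
      · push_cast
        rw [degree_eq_natDegree hb0] at hb ⊢
        have hb' : b.natDegree ≤ n := by exact_mod_cast hb
        by_cases ha0 : a = 0
        · rw [ha0, degree_zero, WithBot.bot_add]; exact WithBot.bot_lt_coe _
        · rw [degree_eq_natDegree ha0] at ha ⊢
          have ha' : a.natDegree < m := by exact_mod_cast ha
          exact_mod_cast (by omega : a.natDegree + b.natDegree < m + n)
    refine degreeLT_mono (show A + f.natDegree * h + (j : ℕ) ≤ M by omega) ?_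
    refine mulmem _ _ _ _ (Submodule.sub_mem _ ?_ ?_) (degree_X_pow_le _)
    · rw [mul_comm (f ^ h)]
      exact mulmem _ _ _ _ (redPart_mem_degreeLT _ _ _ _ (v.1 j).2) hfd
    · exact redPart_mem_degreeLT _ _ _ _ (mulmem _ _ _ _ (v.2 j).2 hfd)
  let L' : ((Fin J → degreeLT K A) × (Fin J → degreeLT K A)) →ₗ[K] (Fin B → degreeLT K M) :=
    LinearMap.pi fun i => LinearMap.codRestrict (degreeLT K M) (LinearMap.proj i ∘ₗ L)
      (fun v => hmem v i)
  have hfr : ∀ n, Module.finrank K (degreeLT K n) = n := fun n => by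
    rw [(degreeLTEquiv K n).finrank_eq]; simp
  have hfin : ∀ n, Module.Finite K (degreeLT K n) := fun n =>
    Module.Finite.equiv (degreeLTEquiv K n).symm
  have hker : LinearMap.ker L' ≠ ⊥ := by
    apply LinearMap.ker_ne_bot_of_finrank_lt
    rw [Module.finrank_prod, Module.finrank_pi_fintype, Module.finrank_pi_fintype]
    simp only [hfr, Finset.sum_const, Finset.card_univ, Fintype.card_fin, smul_eq_mul]
    omega
  obtain ⟨v, hv, hv0⟩ := Submodule.exists_mem_ne_zero_of_ne_bot hker
  refine ⟨fun j => if hj : j < J then (v.1 ⟨j, hj⟩ : K[X]) else 0,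
    fun j => if hj : j < J then (v.2 ⟨j, hj⟩ : K[X]) else 0, ?_, ?_, ?_, ?_⟩
  · intro j; dsimp only; split_ifs
    · exact (v.1 _).2
    · exact Submodule.zero_mem _
  · intro j; dsimp only; split_ifs
    · exact (v.2 _).2
    · exact Submodule.zero_mem _
  · intro hz
    apply hv0
    refine Prod.ext (funext fun j => ?_) (funext fun j => ?_)
    · have := (hz j j.2).1
      simp only [dif_pos j.2] at this
      exact Subtype.ext this
    · have := (hz j j.2).2
      simp only [dif_pos j.2] at this
      exact Subtype.ext this
  · intro i hi
    have h1 : L v ⟨i, hi⟩ = 0 := by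
      have : L' v = 0 := hv
      have := congrArg Subtype.val (congrFun this ⟨i, hi⟩)
      exact this
    rw [hL] at h1
    rw [Finset.sum_range]
    rw [← h1]
    refine Finset.sum_congr rfl fun j _ => ?_
    simp

open Polynomial in
lemma stepanov {K : Type} [Field K] [Fintype K] [DecidableEq K] (p e : ℕ) [Fact p.Prime]
    [CharP K p]
    (hcard : Fintype.card K = (p ^ e) ^ 2) (hodd : Odd (p ^ e))
    (f : K[X]) (hf : Squarefree f) (hdeg : 0 < f.natDegree) (hf0 : f.eval 0 ≠ 0)
    (hB : f.natDegree + 3 ≤ p ^ e) :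
    2 * (Finset.univ.filter (fun x : K => (f.eval x) ^ (((p ^ e) ^ 2 - 1) / 2) = -1)).card ≤
      (p ^ e) ^ 2 + (3 * f.natDegree + 3) * p ^ e := by
  obtain ⟨h, hh⟩ := hodd
  set B := p ^ e with hBdef
  set m := f.natDegree with hm
  have hhalf : (B ^ 2 - 1) / 2 = B * h + h := by
    rw [hh]
    have : (2 * h + 1) ^ 2 = 2 * ((2 * h + 1) * h + h) + 1 := by ring
    omega
  rw [hhalf]
  set A := (B ^ 2 - m) / 2 with hAdef
  set J := h + m + 2 with hJ
  have hmB : m + 3 ≤ B ^ 2 := by nlinarith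
  have hA1 : 2 * A + m ≤ B ^ 2 := by omega
  have hA2 : B ^ 2 ≤ 2 * A + m + 1 := by omega
  have hdim : B * (A + m * h + J) < 2 * (J * A) := by
    exact stepanov_arith1 B h m A J hh hJ hB hA2
  obtain ⟨r, s, hr, hs, hne, hcond⟩ := stepanov_linear f B h A J (A + m * h + J) le_rfl hdim
  have hfrob : ∀ x : K, x ^ (B ^ 2) = x := fun x => by
    rw [← hcard]; exact FiniteField.pow_card x
  set R : K[X] := ∑ j ∈ Finset.range J, (r j + s j * f ^ (B * h + h)) * X ^ (j * B ^ 2) with hR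
  have hRne : R ≠ 0 := by
    intro hR0
    apply hne
    have hB2 : p ^ (e * 2) = B ^ 2 := by rw [pow_mul]
    have := stepanov_nonvanish p (e * 2) (K := K) (by rw [hB2]; exact hfrob)
      (by rw [hB2]; exact Odd.pow ⟨h, hh⟩) f hf hdeg hf0 A (by rw [hB2]; exact hA1) J r s hr hs
    rw [hB2, hhalf] at this
    exact this hR0
  have hdvd : ∀ x : K, (f.eval x) ^ (B * h + h) = -1 → (X - C x) ^ B ∣ R := by
    intro x hx
    set I : Ideal K[X] := Ideal.span {(X - C x) ^ B} with hI
    set π := Ideal.Quotient.mk I with hπ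
    have hdv : ∀ P Q : K[X], (X - C x) ^ B ∣ P - Q → π P = π Q := fun P Q hPQ =>
      Ideal.Quotient.eq.2 (Ideal.mem_span_singleton.2 hPQ)
    have e1 : π (f ^ B) = π (C ((f.eval x) ^ B)) := hdv _ _ (pow_sub_dvd p e f x)
    have e2 : π (X ^ (B ^ 2)) = π (C x) := by
      have : π (X ^ B) = π (C (x ^ B)) := by
        have := pow_sub_dvd p e X x
        rw [eval_X] at this
        exact hdv _ _ this
      rw [sq, pow_mul, map_pow, this, ← map_pow, ← C_pow, ← pow_mul, ← sq, hfrob]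
    have e3 : ∀ P : K[X], π P = ∑ i ∈ Finset.range B, π (X ^ i) *
        π (C ((redPart K B i P).eval x)) := by
      intro P
      conv_lhs => rw [← sum_redPart B (by omega) P]
      rw [map_sum]
      refine Finset.sum_congr rfl fun i _ => ?_
      rw [map_mul, hdv _ _ (redPart_dvd p e i P x)]
    have e4 : π (C ((f.eval x) ^ h) * R) = 0 := by
      have step : C ((f.eval x) ^ h) * R = ∑ j ∈ Finset.range J,
          (C ((f.eval x) ^ h) * r j + s j * f ^ h * (C ((f.eval x) ^ h) * (f ^ B) ^ h)) *
            (X ^ (B ^ 2)) ^ j := by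
        rw [hR, Finset.mul_sum]
        refine Finset.sum_congr rfl fun j _ => ?_
        rw [pow_add, pow_mul f, mul_comm j, pow_mul X]; ring
      have hx' : π (C ((f.eval x) ^ h)) * (π (f ^ B)) ^ h = -1 := by
        rw [e1, ← map_pow, ← map_mul, ← C_pow, ← C_mul, ← pow_mul, ← pow_add, add_comm, hx]
        simp
      have step2 : π (C ((f.eval x) ^ h) * R) = ∑ j ∈ Finset.range J,
          (π (C ((f.eval x) ^ h)) * π (r j) - π (s j * f ^ h)) * π (C (x ^ j)) := by
        rw [step, map_sum]
        refine Finset.sum_congr rfl fun j _ => ?_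
        rw [map_mul, map_add, map_mul, map_mul _ (s j * f ^ h), map_mul _ (C ((f.eval x) ^ h)),
          map_pow π (f ^ B), hx', map_pow π (X ^ (B ^ 2)), e2, ← map_pow π (C x), ← C_pow (a := x)]
        ring
      have step3 : ∀ j, (π (C ((f.eval x) ^ h)) * π (r j) - π (s j * f ^ h)) * π (C (x ^ j)) =
          ∑ i ∈ Finset.range B, π (X ^ i) * π (C ((((f ^ h * redPart K B i (r j) -
        redPart K B i (s j * f ^ h)) * X ^ j)).eval x)) := by
        intro j
        rw [e3 (r j), e3 (s j * f ^ h), Finset.mul_sum, ← Finset.sum_sub_distrib, Finset.sum_mul]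
        refine Finset.sum_congr rfl fun i _ => ?_
        simp only [eval_mul, eval_sub, eval_pow, eval_X, map_mul, map_sub, C_pow]
        ring
      rw [step2, Finset.sum_congr rfl fun j _ => step3 j, Finset.sum_comm]
      refine Finset.sum_eq_zero fun i hi => ?_
      rw [← Finset.mul_sum, ← map_sum, ← map_sum, ← eval_finsetSum,
        hcond i (Finset.mem_range.1 hi)]
      simp
    have hu : IsUnit (C ((f.eval x) ^ h)) := by
      rw [isUnit_C, isUnit_iff_ne_zero]
      intro h0
      rw [pow_add, h0, mul_zero] at hx
      exact one_ne_zero (neg_eq_zero.1 hx.symm)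
    have := Ideal.mem_span_singleton.1 (Ideal.Quotient.eq_zero_iff_mem.1 e4)
    exact hu.dvd_mul_left.1 this
  set S := Finset.univ.filter (fun x : K => (f.eval x) ^ (B * h + h) = -1) with hS
  have hprod : ∏ x ∈ S, (X - C x) ^ B ∣ R := by
    refine Finset.prod_dvd_of_coprime ?_ fun x hx => hdvd x (Finset.mem_filter.1 hx).2
    intro x _ y _ hxy
    exact ((isCoprime_X_sub_C_of_isUnit_sub (sub_ne_zero.2 hxy).isUnit).pow)
  have hd1 := natDegree_le_of_dvd hprod hRne
  have hd2 : (∏ x ∈ S, (X - C x) ^ B).natDegree = S.card * B := by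
    rw [natDegree_prod_of_monic _ _ (fun x _ => (monic_X_sub_C x).pow _)]
    simp
  have hd3 : R.natDegree ≤ A + m * (B * h + h) + (J - 1) * B ^ 2 := by
    rw [hR]
    refine natDegree_sum_le_of_forall_le _ _ fun j hj => ?_
    have hj' := Finset.mem_range.1 hj
    have hA' : ∀ P ∈ degreeLT K A, P.natDegree ≤ A := fun P hP =>
      natDegree_le_of_degree_le (mem_degreeLT.1 hP).le
    refine natDegree_mul_le.trans (add_le_add ?_ ?_)
    · refine (natDegree_add_le _ _).trans (max_le ((hA' _ (hr j)).trans (by omega)) ?_)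
      refine natDegree_mul_le.trans (add_le_add (hA' _ (hs j)) ?_)
      exact natDegree_pow_le.trans (by rw [mul_comm])
    · rw [natDegree_X_pow]
      exact Nat.mul_le_mul_right _ (by omega)
  rw [hd2] at hd1
  have hfin : S.card * B ≤ A + m * (B * h + h) + (J - 1) * B ^ 2 := hd1.trans hd3
  have hJ1 : J - 1 = h + m + 1 := by omega
  rw [hJ1] at hfin
  have hBpos : 0 < B := by omega
  have : (2 * S.card) * B ≤ (B ^ 2 + (3 * m + 3) * B) * B := by
    exact stepanov_arith2 B h m A _ hh hA1 hfin
  exact Nat.le_of_mul_le_mul_right this hBpos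

open Polynomial in
lemma pointcount {F K : Type} [Field F] [Field K] [Fintype F] [Fintype K] [DecidableEq K]
    [DecidableEq F] [Algebra F K]
    (n : ℕ) (hn : Module.finrank F K = 2 * n) (hodd : Odd (Fintype.card F)) (a b : F)
    (ha : a ≠ 0) (hb : b ≠ 0) (hlarge : 2 * Fintype.card F + 3 ≤ Fintype.card F ^ n) :
    (Fintype.card F ^ n) ^ 2 ≤ Fintype.card F * (Finset.univ.filter (fun x : K => x ≠ 0 ∧
      Algebra.trace F K (algebraMap F K a * x + algebraMap F K b * x⁻¹) = 0)).card
      + (10 * Fintype.card F + 3) * Fintype.card F ^ n := by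
  obtain ⟨p, hp⟩ := CharP.exists F
  have := hp
  obtain ⟨r, hpp, hq⟩ := FiniteField.card F p
  have : Fact p.Prime := ⟨hpp⟩
  have : CharP K p := charP_of_injective_algebraMap (algebraMap F K).injective p
  set q := Fintype.card F with hqdef
  have hcardK : Fintype.card K = (q ^ n) ^ 2 := by
    rw [Module.card_eq_pow_finrank (K := F) (V := K), hn, mul_comm, pow_mul]
  have hB : q ^ n = p ^ ((r : ℕ) * n) := by rw [hq, pow_mul]
  have hBodd : Odd (q ^ n) := hodd.pow
  have hp2 : p ≠ 2 := by
    rintro rfl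
    rw [hq] at hodd
    have : Even (2 ^ (r : ℕ)) := (Nat.even_pow.2 ⟨even_two, r.2.ne'⟩)
    exact (Nat.not_even_iff_odd.2 hodd) this
  have h2 : (2 : K) ≠ 0 := by
    intro h
    have h' : ((2 : ℕ) : K) = 0 := by exact_mod_cast h
    have := (CharP.cast_eq_zero_iff K p 2).1 h'
    exact hp2 ((Nat.prime_dvd_prime_iff_eq hpp Nat.prime_two).1 this)
  have hqK : (q : K) = 0 := by
    rw [hq]; push_cast; rw [CharP.cast_eq_zero K p]; exact zero_pow r.2.ne'
  have hq1 : 1 < q := Fintype.one_lt_card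
  set a' := algebraMap F K a with ha'
  set b' := algebraMap F K b with hb'
  have ha0 : a' ≠ 0 := by simpa [ha'] using ha
  have hb0 : b' ≠ 0 := by simpa [hb'] using hb
  have h4 : (4 : K) * a' * b' ≠ 0 := by
    have : (4 : K) = 2 * 2 := by norm_num
    rw [this]; positivity
  set D : K[X] := (X ^ q - X) ^ 2 - C (4 * a' * b') with hD
  have hDev : ∀ y, D.eval y = (y ^ q - y) ^ 2 - 4 * a' * b' := by intro y; simp [hD]
  have hudeg : (X ^ q - X : K[X]).natDegree = q := FiniteField.X_pow_card_sub_X_natDegree_eq K hq1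
  have hDdeg : D.natDegree = 2 * q := by
    rw [hD, natDegree_sub_C, natDegree_pow, hudeg]
  have hDder : derivative D = C (-2) * (X ^ q - X) := by
    rw [hD]
    simp only [derivative_sub, derivative_pow, derivative_C, derivative_X]
    rw [show ((q : ℕ) : K) = 0 from hqK]
    simp
  have hDsep : D.Separable := by
    refine ⟨C (-(4 * a' * b')⁻¹), C (-(2 : K)⁻¹ * (4 * a' * b')⁻¹) * (X ^ q - X), ?_⟩
    rw [hDder, hD]
    have e1 : C (-(2 : K)⁻¹ * (4 * a' * b')⁻¹) * (X ^ q - X) * (C (-2) * (X ^ q - X)) =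
      C ((4 * a' * b')⁻¹) * (X ^ q - X : K[X]) ^ 2 := by
      have : (-(2 : K)⁻¹ * (4 * a' * b')⁻¹) * (-2) = (4 * a' * b')⁻¹ := by
        generalize (4 * a' * b')⁻¹ = c
        field_simp
      generalize (4 * a' * b')⁻¹ = c at *
      have h5 := congrArg C this
      rw [C_mul (b := -2)] at h5
      rw [← h5]; ring
    rw [e1, mul_sub, ← C_mul]
    have : -(4 * a' * b')⁻¹ * (4 * a' * b') = -1 := by
      rw [neg_mul, inv_mul_cancel₀ h4]
    rw [this, C_neg, C_neg, C_1]; ring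
  have hst := stepanov p (r * n) (K := K) (by rw [hcardK, hB]) (by rwa [← hB]) D
    hDsep.squarefree (by omega) (by
      rw [hDev]; intro h; apply h4; rw [zero_pow (by omega)] at h
      linear_combination -h) (by rw [hDdeg, ← hB]; exact hlarge)
  rw [← hB, hDdeg] at hst
  set S := Finset.univ.filter (fun x : K => (D.eval x) ^ (((q ^ n) ^ 2 - 1) / 2) = -1) with hS
  set S0 := Finset.univ.filter (fun x : K => D.eval x = 0) with hS0
  set S1 := Finset.univ.filter (fun x : K => D.eval x ≠ 0 ∧ IsSquare (D.eval x)) with hS1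
  set T := (Finset.univ.filter (fun x : K => x ≠ 0 ∧
      Algebra.trace F K (a' * x + b' * x⁻¹) = 0)) with hT
  have hD0 : D ≠ 0 := hDsep.squarefree.ne_zero
  have hS0c : S0.card ≤ 2 * q := by
    rw [← hDdeg]
    refine le_trans ?_ (card_roots' D)
    refine (Finset.card_le_card ?_).trans (Multiset.toFinset_card_le D.roots)
    intro x hx
    rw [Multiset.mem_toFinset, mem_roots hD0]
    exact (Finset.mem_filter.1 hx).2
  have hcov : Fintype.card K ≤ S.card + S0.card + S1.card := by
    rw [← Finset.card_univ]
    refine le_trans (Finset.card_le_card (t := S ∪ S0 ∪ S1) ?_)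
      ((Finset.card_union_le _ _).trans (Nat.add_le_add_right (Finset.card_union_le _ _) _))
    intro x _
    simp only [Finset.mem_union, hS, hS0, hS1, Finset.mem_filter, Finset.mem_univ, true_and]
    by_cases h0 : D.eval x = 0
    · exact Or.inl (Or.inr h0)
    · have hrc : ringChar K ≠ 2 := by rw [ringChar.eq K p]; exact hp2
      have h3 : ((q ^ n) ^ 2 - 1) / 2 = Fintype.card K / 2 := by
        rw [hcardK]
        obtain ⟨t, ht⟩ := (hBodd.pow : Odd ((q ^ n) ^ 2))
        omega
      rcases FiniteField.pow_dichotomy hrc h0 with h | h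
      · exact Or.inr ⟨h0, (FiniteField.isSquare_iff hrc h0).2 h⟩
      · exact Or.inl (Or.inl (by rw [h3]; exact h))
  set P := Finset.univ.filter (fun z : K × K => z.1 ≠ 0 ∧ z.2 ∈ S1 ∧
    z.2 ^ q - z.2 = a' * z.1 + b' * z.1⁻¹) with hP
  have hP1 : 2 * S1.card ≤ P.card := by
    refine Finset.mul_card_image_le_card_of_maps_to (f := Prod.snd)
      (fun z hz => (Finset.mem_filter.1 hz).2.2.1) 2 ?_
    intro y hy
    obtain ⟨hy0, w, hw⟩ := (Finset.mem_filter.1 hy).2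
    have hw0 : w ≠ 0 := by rintro rfl; exact hy0 (by rw [hw]; ring)
    rw [hDev] at hw
    have sol : ∀ v, v * v = w * w → ((y ^ q - y + v) / (2 * a'), y) ∈ P.filter (fun z => z.2 = y) := by
      intro v hv
      rw [Finset.mem_filter, hP, Finset.mem_filter]
      have hx0 : (y ^ q - y + v) / (2 * a') ≠ 0 := by
        intro h
        have h5 : y ^ q - y + v = 0 := by
          rcases div_eq_zero_iff.1 h with h | h
          · exact h
          · exact absurd h (mul_ne_zero h2 ha0)
        apply h4
        have : v = -(y ^ q - y) := by linear_combination h5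
        rw [this] at hv
        linear_combination -hw + hv
      refine ⟨⟨Finset.mem_univ _, hx0, hy, ?_⟩, rfl⟩
      have hz : (y ^ q - y + v) ≠ 0 := fun h => hx0 (by rw [h, zero_div])
      dsimp only
      generalize y ^ q - y = u at *
      rw [inv_div]
      field_simp
      linear_combination hw - hv
    have hne : ((y ^ q - y + w) / (2 * a'), y) ≠ ((y ^ q - y + -w) / (2 * a'), y) := by
      intro h
      have h5 := congrArg Prod.fst h
      dsimp only at h5
      have h6 := (div_left_inj' (mul_ne_zero h2 ha0)).1 h5
      apply mul_ne_zero h2 hw0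
      linear_combination h6
    rw [← Finset.card_pair hne]
    refine Finset.card_le_card ?_
    intro z hz
    rcases Finset.mem_insert.1 hz with rfl | hz
    · exact sol w rfl
    · rw [Finset.mem_singleton.1 hz]; exact sol (-w) (by ring)
  have hP2 : P.card ≤ q * T.card := by
    refine Finset.card_le_mul_card_image_of_maps_to (f := Prod.fst) ?_ q ?_
    · intro z hz
      obtain ⟨_, h1, _, h3⟩ := Finset.mem_filter.1 hz
      rw [hT, Finset.mem_filter]
      refine ⟨Finset.mem_univ _, h1, ?_⟩
      rw [← h3, map_sub]
      have : z.2 ^ q = FiniteField.frobeniusAlgEquivOfAlgebraic F K z.2 := by simp [hqdef]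
      rw [this, Algebra.trace_eq_of_algEquiv, sub_self]
    · intro x hx
      have hpne : (X ^ q - X - C (a' * x + b' * x⁻¹) : K[X]) ≠ 0 := by
        intro h
        have := congrArg natDegree h
        rw [natDegree_sub_C, hudeg, natDegree_zero] at this
        omega
      have hcr := card_roots' (X ^ q - X - C (a' * x + b' * x⁻¹) : K[X])
      rw [natDegree_sub_C, hudeg] at hcr
      refine le_trans ?_ hcr
      refine le_trans ?_ (Multiset.toFinset_card_le _)
      refine Finset.card_le_card_of_injOn Prod.snd ?_ ?_
      · intro z hz
        have hz' := Finset.mem_filter.1 hz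
        have hz2 := (Finset.mem_filter.1 hz'.1).2
        rw [Finset.mem_coe, Multiset.mem_toFinset, mem_roots hpne]
        rw [← hz'.2]
        simp [hz2.2.2]
      · intro z hz z' hz' h
        have e1 := (Finset.mem_filter.1 (Finset.mem_coe.1 hz)).2
        have e2 := (Finset.mem_filter.1 (Finset.mem_coe.1 hz')).2
        exact Prod.ext (e1.trans e2.symm) h
  rw [hcardK] at hcov
  have hBpos : 1 ≤ q ^ n := Nat.one_le_pow _ _ (by omega)
  nlinarith

open Polynomial in
lemma finite_natDegree_le (F : Type) [Field F] [Fintype F] (n : ℕ) :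
    {f : F[X] | f.natDegree ≤ n}.Finite := by
  have h1 : Module.Finite F (degreeLT F (n + 1)) := Module.Finite.equiv (degreeLTEquiv F (n + 1)).symm
  have h2 : Finite (degreeLT F (n + 1)) := Module.finite_of_finite F
  have h3 : (↑(degreeLT F (n + 1)) : Set F[X]).Finite := h2
  refine h3.subset ?_
  intro f hf
  rw [SetLike.mem_coe, mem_degreeLT]
  refine degree_le_natDegree.trans_lt ?_
  have : f.natDegree < n + 1 := Nat.lt_succ_of_le hf
  exact_mod_cast this

open Polynomial in
/-- monic polynomials of degree `n` -/
noncomputable def monicDeg (F : Type) [Field F] [Fintype F] (n : ℕ) : Finset F[X] :=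
  ((finite_natDegree_le F n).subset
    (fun f (hf : f ∈ {f : F[X] | f.Monic ∧ f.natDegree = n}) => hf.2.le)).toFinset

open Polynomial in
/-- monic irreducible polynomials of degree at most `n` -/
noncomputable def irrLE (F : Type) [Field F] [Fintype F] (n : ℕ) : Finset F[X] :=
  ((finite_natDegree_le F n).subset
    (fun f (hf : f ∈ {f : F[X] | f.Monic ∧ Irreducible f ∧ f.natDegree ≤ n}) => hf.2.2)).toFinset

open Polynomial in
lemma mem_monicDeg {F : Type} [Field F] [Fintype F] {n : ℕ} {f : F[X]} :
    f ∈ monicDeg F n ↔ f.Monic ∧ f.natDegree = n := by simp [monicDeg]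

open Polynomial in
lemma mem_irrLE {F : Type} [Field F] [Fintype F] {n : ℕ} {f : F[X]} :
    f ∈ irrLE F n ↔ f.Monic ∧ Irreducible f ∧ f.natDegree ≤ n := by simp [irrLE]

/-- coefficients of the L-function -/
noncomputable def Lco (F : Type) [Field F] [Fintype F] (lam : Polynomial F → ℂ) (n : ℕ) : ℂ :=
  ∑ f ∈ monicDeg F n, lam f

/-- power sums over prime powers -/
noncomputable def Tco (F : Type) [Field F] [Fintype F] (lam : Polynomial F → ℂ) (j : ℕ) : ℂ :=
  ∑ P ∈ (irrLE F j).filter (fun P => P.natDegree ∣ j), (P.natDegree : ℂ) * lam P ^ (j / P.natDegree)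

open Polynomial in
lemma natDegree_eq_sum_irr {F : Type} [Field F] [Fintype F] [DecidableEq F] {n : ℕ} {f : F[X]}
    (hf : f ∈ monicDeg F n) :
    n = ∑ P ∈ irrLE F n, ∑ k ∈ Finset.Icc 1 n, (open Classical in if P ^ k ∣ f then P.natDegree else 0) := by
  classical
  obtain ⟨hm, hn⟩ := mem_monicDeg.1 hf
  set s := UniqueFactorizationMonoid.normalizedFactors f with hs
  have hprod : s.prod = f := by
    rw [UniqueFactorizationMonoid.prod_normalizedFactors_eq hm.ne_zero, hm.normalize_eq_self]
  have hmon : ∀ P ∈ s, P.Monic := by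
    intro P hP
    have h1 := UniqueFactorizationMonoid.normalize_normalized_factor P hP
    have h2 := (UniqueFactorizationMonoid.irreducible_of_normalized_factor P hP).ne_zero
    rw [← h1]; exact monic_normalize h2
  have hsub : s.toFinset ⊆ irrLE F n := by
    intro P hP
    rw [Multiset.mem_toFinset] at hP
    refine mem_irrLE.2 ⟨hmon P hP, UniqueFactorizationMonoid.irreducible_of_normalized_factor P hP, ?_⟩
    rw [← hn]
    exact natDegree_le_of_dvd (UniqueFactorizationMonoid.dvd_of_mem_normalizedFactors hP) hm.ne_zero
  have hcount : ∀ P ∈ irrLE F n, ∑ k ∈ Finset.Icc 1 n, (if P ^ k ∣ f then P.natDegree else 0) =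
      s.count P * P.natDegree := by
    intro P hP
    obtain ⟨hPm, hPi, hPn⟩ := mem_irrLE.1 hP
    have hdv : ∀ k, P ^ k ∣ f ↔ k ≤ s.count P := by
      intro k
      rw [pow_dvd_iff_le_emultiplicity,
        UniqueFactorizationMonoid.emultiplicity_eq_count_normalizedFactors hPi hm.ne_zero,
        hPm.normalize_eq_self]
      exact_mod_cast Iff.rfl
    have hle : s.count P ≤ n := by
      have h1 := natDegree_le_of_dvd ((hdv _).2 le_rfl) hm.ne_zero
      rw [natDegree_pow, hn] at h1
      have h2 : 1 ≤ P.natDegree := hPi.natDegree_pos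
      nlinarith
    rw [← Finset.sum_filter, Finset.sum_const, smul_eq_mul]
    congr 1
    have : (Finset.Icc 1 n).filter (fun k => P ^ k ∣ f) = Finset.Icc 1 (s.count P) := by
      ext k
      rw [Finset.mem_filter, Finset.mem_Icc, Finset.mem_Icc, hdv]
      omega
    rw [this]; simp
  rw [Finset.sum_congr rfl hcount]
  have h3 : n = (s.map natDegree).sum := by
    conv_lhs => rw [← hn, ← hprod]
    exact natDegree_multiset_prod_of_monic _ hmon
  refine h3.trans ?_
  rw [Finset.sum_multiset_map_count]
  simp only [smul_eq_mul]
  refine Finset.sum_subset hsub fun P _ hP => ?_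
  rw [Multiset.mem_toFinset] at hP
  rw [Multiset.count_eq_zero_of_notMem hP, zero_mul]

open Polynomial in
lemma lam_pow {F : Type} [Field F] {lam : F[X] → ℂ} (h1 : lam 1 = 1)
    (hmul : ∀ f g : F[X], f.Monic → g.Monic → lam (f * g) = lam f * lam g)
    {P : F[X]} (hP : P.Monic) (k : ℕ) : lam (P ^ k) = lam P ^ k := by
  induction k with
  | zero => simpa using h1
  | succ k ih => rw [pow_succ, hmul _ _ (hP.pow k) hP, ih, pow_succ]

open Polynomial in
lemma sum_dvd_monicDeg {F : Type} [Field F] [Fintype F] [DecidableEq F] {lam : F[X] → ℂ}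
    (h1 : lam 1 = 1)
    (hmul : ∀ f g : F[X], f.Monic → g.Monic → lam (f * g) = lam f * lam g)
    {P : F[X]} (hP : P.Monic) (k n : ℕ) (hk : k * P.natDegree ≤ n) :
    ∑ f ∈ monicDeg F n, (open Classical in if P ^ k ∣ f then lam f else 0) =
      lam P ^ k * Lco F lam (n - k * P.natDegree) := by
  classical
  rw [← Finset.sum_filter, Lco, Finset.mul_sum]
  symm
  refine Finset.sum_bij (fun g _ => P ^ k * g) ?_ ?_ ?_ ?_
  · intro g hg
    obtain ⟨hg1, hg2⟩ := mem_monicDeg.1 hg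
    refine Finset.mem_filter.2 ⟨mem_monicDeg.2 ⟨(hP.pow k).mul hg1, ?_⟩, dvd_mul_right _ _⟩
    rw [(hP.pow k).natDegree_mul hg1, hP.natDegree_pow, hg2]; omega
  · intro g _ g' _ h
    exact mul_left_cancel₀ (hP.pow k).ne_zero h
  · intro f hf
    obtain ⟨hf1, g, rfl⟩ := Finset.mem_filter.1 hf
    obtain ⟨hf2, hf3⟩ := mem_monicDeg.1 hf1
    have hg : g.Monic := (hP.pow k).of_mul_monic_left hf2
    refine ⟨g, mem_monicDeg.2 ⟨hg, ?_⟩, rfl⟩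
    rw [(hP.pow k).natDegree_mul hg, hP.natDegree_pow] at hf3; omega
  · intro g hg
    rw [hmul _ _ (hP.pow k) (mem_monicDeg.1 hg).1, lam_pow h1 hmul hP]

open Polynomial in
lemma euler_identity {F : Type} [Field F] [Fintype F] [DecidableEq F] {lam : F[X] → ℂ}
    (h1 : lam 1 = 1)
    (hmul : ∀ f g : F[X], f.Monic → g.Monic → lam (f * g) = lam f * lam g) (n : ℕ) :
    (n : ℂ) * Lco F lam n = ∑ j ∈ Finset.Icc 1 n, Tco F lam j * Lco F lam (n - j) := by
  classical
  have lhs : (n : ℂ) * Lco F lam n = ∑ P ∈ irrLE F n, ∑ k ∈ Finset.Icc 1 n, (P.natDegree : ℂ) *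
      ∑ f ∈ monicDeg F n, (if P ^ k ∣ f then lam f else 0) := by
    rw [Lco, Finset.mul_sum]
    have : ∀ f ∈ monicDeg F n, (n : ℂ) * lam f = ∑ P ∈ irrLE F n, ∑ k ∈ Finset.Icc 1 n,
        (P.natDegree : ℂ) * (if P ^ k ∣ f then lam f else 0) := by
      intro f hf
      have h := congrArg (Nat.cast : ℕ → ℂ) (natDegree_eq_sum_irr hf)
      conv_lhs => rw [h]
      push_cast
      rw [Finset.sum_mul]
      refine Finset.sum_congr rfl fun P _ => ?_
      rw [Finset.sum_mul]
      refine Finset.sum_congr rfl fun k _ => ?_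
      split_ifs <;> simp
    rw [Finset.sum_congr rfl this, Finset.sum_comm]
    refine Finset.sum_congr rfl fun P _ => ?_
    rw [Finset.sum_comm]
    refine Finset.sum_congr rfl fun k _ => ?_
    rw [Finset.mul_sum]
  have rhs : ∀ j ∈ Finset.Icc 1 n, Tco F lam j * Lco F lam (n - j) = ∑ P ∈ irrLE F n,
      if P.natDegree ∣ j then (P.natDegree : ℂ) * lam P ^ (j / P.natDegree) * Lco F lam (n - j)
        else 0 := by
    intro j hj
    rw [Finset.mem_Icc] at hj
    rw [← Finset.sum_filter, Tco, Finset.sum_mul]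
    refine Finset.sum_congr ?_ fun _ _ => rfl
    ext P
    simp only [Finset.mem_filter, mem_irrLE]
    constructor
    · rintro ⟨⟨h1, h2, h3⟩, h4⟩; exact ⟨⟨h1, h2, h3.trans hj.2⟩, h4⟩
    · rintro ⟨⟨h1, h2, h3⟩, h4⟩; exact ⟨⟨h1, h2, Nat.le_of_dvd (by omega) h4⟩, h4⟩
  rw [lhs, Finset.sum_congr rfl rhs, Finset.sum_comm (s := Finset.Icc 1 n)]
  refine Finset.sum_congr rfl fun P hP => ?_
  obtain ⟨hPm, hPi, hPn⟩ := mem_irrLE.1 hP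
  have hd : 1 ≤ P.natDegree := hPi.natDegree_pos
  have : ∀ k ∈ Finset.Icc 1 n, (P.natDegree : ℂ) *
      ∑ f ∈ monicDeg F n, (if P ^ k ∣ f then lam f else 0) = if k * P.natDegree ≤ n then
        (P.natDegree : ℂ) * (lam P ^ k * Lco F lam (n - k * P.natDegree)) else 0 := by
    intro k _
    split_ifs with h
    · rw [sum_dvd_monicDeg h1 hmul hPm k n h]
    · rw [Finset.sum_eq_zero, mul_zero]
      intro f hf
      obtain ⟨hf1, hf2⟩ := mem_monicDeg.1 hf
      rw [if_neg]
      intro hdv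
      have := natDegree_le_of_dvd hdv hf1.ne_zero
      rw [natDegree_pow, hf2] at this
      exact h this
  rw [Finset.sum_congr rfl this, ← Finset.sum_filter, ← Finset.sum_filter]
  refine Finset.sum_bij (fun k _ => k * P.natDegree) ?_ ?_ ?_ ?_
  · intro k hk
    simp only [Finset.mem_filter, Finset.mem_Icc] at hk ⊢
    exact ⟨⟨Nat.mul_pos hk.1.1 hd, hk.2⟩, dvd_mul_left _ _⟩
  · intro k _ k' _ h
    exact Nat.eq_of_mul_eq_mul_right hd h
  · intro j hj
    simp only [Finset.mem_filter, Finset.mem_Icc] at hj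
    obtain ⟨⟨hj1, hj2⟩, k, rfl⟩ := hj
    refine ⟨k, ?_, mul_comm _ _⟩
    simp only [Finset.mem_filter, Finset.mem_Icc]
    have : 1 ≤ k := by
      rcases Nat.eq_zero_or_pos k with h | h
      · subst h; simp at hj1
      · exact h
    refine ⟨⟨this, by nlinarith⟩, by rw [mul_comm]; exact hj2⟩
  · intro k _
    rw [Nat.mul_div_cancel _ hd]; ring

open Polynomial in
/-- The multiplicative function attached to a Kloosterman sum. -/
noncomputable def klam {F : Type} [Field F] [DecidableEq F] (ψ : AddChar F ℂ) (a b : F) (f : F[X]) : ℂ :=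
  if f.coeff 0 = 0 then 0 else ψ (-(a * f.nextCoeff + b * (f.coeff 1 / f.coeff 0)))

open Polynomial in
lemma klam_one {F : Type} [Field F] [DecidableEq F] (ψ : AddChar F ℂ) (a b : F) :
    klam ψ a b 1 = 1 := by
  have : nextCoeff (1 : F[X]) = 0 := by rw [← C_1]; exact nextCoeff_C_eq_zero 1
  simp [klam, this, coeff_one]

open Polynomial in
lemma klam_mul {F : Type} [Field F] [DecidableEq F] (ψ : AddChar F ℂ) (a b : F) (f g : F[X])
    (hf : f.Monic) (hg : g.Monic) : klam ψ a b (f * g) = klam ψ a b f * klam ψ a b g := by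
  unfold klam
  rw [mul_coeff_zero, hf.nextCoeff_mul hg, mul_coeff_one]
  by_cases h1 : f.coeff 0 = 0
  · simp [h1]
  by_cases h2 : g.coeff 0 = 0
  · simp [h2]
  rw [if_neg (mul_ne_zero h1 h2), if_neg h1, if_neg h2, ← AddChar.map_add_eq_mul]
  congr 1
  field_simp
  ring

open Polynomial in
lemma klam_L0 {F : Type} [Field F] [Fintype F] [DecidableEq F] (ψ : AddChar F ℂ) (a b : F) :
    Lco F (klam ψ a b) 0 = 1 := by
  have : monicDeg F 0 = {1} := by
    ext f
    rw [mem_monicDeg, Finset.mem_singleton]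
    constructor
    · rintro ⟨h1, h2⟩; exact h1.natDegree_eq_zero.1 h2
    · rintro rfl; simp
  rw [Lco, this, Finset.sum_singleton, klam_one]

/-- Kloosterman sum -/
noncomputable def kloos {F : Type} [Field F] [Fintype F] [DecidableEq F] (ψ : AddChar F ℂ) (a b : F) : ℂ :=
  ∑ x ∈ Finset.univ.filter (fun x : F => x ≠ 0), ψ (a * x + b * x⁻¹)

open Polynomial in
lemma klam_L1 {F : Type} [Field F] [Fintype F] [DecidableEq F] (ψ : AddChar F ℂ) (a b : F) :
    Lco F (klam ψ a b) 1 = kloos ψ a b := by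
  rw [Lco, kloos, Finset.sum_filter]
  symm
  refine Finset.sum_bij (fun x _ => X - C x) ?_ ?_ ?_ ?_
  · intro x _; exact mem_monicDeg.2 ⟨monic_X_sub_C x, natDegree_X_sub_C x⟩
  · intro x _ y _ h; simpa using h
  · intro f hf
    obtain ⟨h1, h2⟩ := mem_monicDeg.1 hf
    refine ⟨-f.coeff 0, Finset.mem_univ _, ?_⟩
    conv_rhs => rw [h1.eq_X_add_C h2]
    simp
  · intro x _
    unfold klam
    rw [nextCoeff_X_sub_C]
    by_cases hx : x = 0
    · simp [hx]
    · simp [hx, coeff_X, coeff_C]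
      congr 1
      field_simp
      ring

open Polynomial in
lemma klam_Ln {F : Type} [Field F] [Fintype F] [DecidableEq F] (ψ : AddChar F ℂ) (hψ : ψ ≠ 1) (a b : F)
    (ha : a ≠ 0) (n : ℕ) (hn : 3 ≤ n) :
    Lco F (klam ψ a b) n = 0 := by
  obtain ⟨t0, ht0⟩ := AddChar.ne_one_iff.1 hψ
  set t := -(t0 / a) with ht
  have hdeg : ∀ (s : F) (f : F[X]), f ∈ monicDeg F n → (f + C s * X ^ (n - 1)) ∈ monicDeg F n := by
    intro s f hf
    obtain ⟨h1, h2⟩ := mem_monicDeg.1 hf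
    have hd : (C s * X ^ (n - 1)).degree < f.degree := by
      rw [degree_eq_natDegree h1.ne_zero, h2]
      refine (degree_C_mul_X_pow_le _ _).trans_lt ?_
      exact_mod_cast (by omega : n - 1 < n)
    refine mem_monicDeg.2 ⟨h1.add_of_left hd, ?_⟩
    rw [natDegree_add_eq_left_of_degree_lt hd, h2]
  have key : ψ t0 * Lco F (klam ψ a b) n = Lco F (klam ψ a b) n := by
    rw [Lco, Finset.mul_sum]
    refine Finset.sum_bij (fun f _ => f + C t * X ^ (n - 1)) ?_ ?_ ?_ ?_
    · intro f hf; exact hdeg t f hf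
    · intro f _ g _ h; simpa using h
    · intro f hf
      refine ⟨f + C (-t) * X ^ (n - 1), hdeg _ f hf, ?_⟩
      simp
    · intro f hf
      have hf' := hdeg t f hf
      have e0 : (f + C t * X ^ (n - 1)).coeff 0 = f.coeff 0 := by
        rw [coeff_add, coeff_C_mul, coeff_X_pow, if_neg (by omega)]; simp
      have e1 : (f + C t * X ^ (n - 1)).coeff 1 = f.coeff 1 := by
        rw [coeff_add, coeff_C_mul, coeff_X_pow, if_neg (by omega)]; simp
      have e2 : (f + C t * X ^ (n - 1)).nextCoeff = f.nextCoeff + t := by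
        have h2 := (mem_monicDeg.1 hf).2
        have h2' := (mem_monicDeg.1 hf').2
        rw [nextCoeff_of_natDegree_pos (by omega), nextCoeff_of_natDegree_pos (by omega), h2, h2',
          coeff_add, coeff_C_mul, coeff_X_pow, if_pos rfl, mul_one]
      unfold klam
      rw [e0, e1, e2]
      split_ifs
      · simp
      · rw [← AddChar.map_add_eq_mul]
        congr 1
        rw [ht]; field_simp; ring
  have : (ψ t0 - 1) * Lco F (klam ψ a b) n = 0 := by rw [sub_mul, key, one_mul, sub_self]
  rcases mul_eq_zero.1 this with h | h
  · exact absurd (sub_eq_zero.1 h) ht0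
  · exact h

open Polynomial in
lemma klam_L2 {F : Type} [Field F] [Fintype F] [DecidableEq F] (ψ : AddChar F ℂ) (hψ : ψ.IsPrimitive) (a b : F)
    (ha : a ≠ 0) (hb : b ≠ 0) :
    Lco F (klam ψ a b) 2 = Fintype.card F := by
  have h1 : Lco F (klam ψ a b) 2 = ∑ p : F × F, klam ψ a b (X ^ 2 + C p.1 * X + C p.2) := by
    rw [Lco]
    symm
    have hdeg : ∀ p : F × F, (C p.1 * X + C p.2).degree < (X ^ 2 : F[X]).degree := by
      intro p
      rw [degree_X_pow]
      exact degree_linear_le.trans_lt (by norm_num)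
    refine Finset.sum_bij (fun p _ => X ^ 2 + C p.1 * X + C p.2) ?_ ?_ ?_ ?_
    · intro p _
      rw [add_assoc]
      refine mem_monicDeg.2 ⟨(monic_X_pow 2).add_of_left (hdeg p), ?_⟩
      rw [natDegree_add_eq_left_of_degree_lt (hdeg p), natDegree_X_pow]
    · intro p _ p' _ h
      have e0 := congrArg (fun f => coeff f 0) h
      have e1 := congrArg (fun f => coeff f 1) h
      simp [coeff_X, coeff_C] at e0 e1
      exact Prod.ext e1 e0
    · intro f hf
      obtain ⟨h1, h2⟩ := mem_monicDeg.1 hf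
      refine ⟨(f.coeff 1, f.coeff 0), Finset.mem_univ _, ?_⟩
      conv_rhs => rw [f.as_sum_range_C_mul_X_pow, h2]
      have : f.coeff 2 = 1 := by rw [← h2]; exact h1
      simp [Finset.sum_range_succ, this]
      ring
    · intro p _; rfl
  have h2 : ∀ c1 c0 : F, klam ψ a b (X ^ 2 + C c1 * X + C c0) =
      if c0 = 0 then 0 else ψ ((-(a + b / c0)) * c1) := by
    intro c1 c0
    have hn : (X ^ 2 + C c1 * X + C c0 : F[X]).natDegree = 2 := by
      have := natDegree_quadratic (a := (1:F)) (b := c1) (c := c0) one_ne_zero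
      simpa using this
    unfold klam
    rw [nextCoeff_of_natDegree_pos (by omega), hn]
    simp [coeff_X, coeff_C]
    split_ifs
    · rfl
    · congr 1; field_simp
  rw [h1, Fintype.sum_prod_type, Finset.sum_comm]
  simp only [h2]
  rw [Finset.sum_eq_single (-b / a)]
  · have h0 : -b / a ≠ 0 := div_ne_zero (neg_ne_zero.2 hb) ha
    have : a + b / (-b / a) = 0 := by field_simp; ring
    simp [h0, this, ha, hb]
  · intro c0 _ hc
    split_ifs with h
    · simp
    · have hne : -(a + b / c0) ≠ 0 := by
        intro h0
        apply hc
        field_simp at h0 ⊢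
        linear_combination -h0
      have := AddChar.sum_mulShift (-(a + b / c0)) hψ
      simp only [hne, if_false] at this
      simpa [mul_comm] using this
  · simp

open Polynomial IntermediateField in
lemma minpoly_inv_nextCoeff {F K : Type} [Field F] [Field K] [Algebra F K] [FiniteDimensional F K]
    (x : K) (hx : x ≠ 0) :
    (minpoly F x).coeff 0 ≠ 0 ∧ (minpoly F x⁻¹).nextCoeff = (minpoly F x).coeff 1 / (minpoly F x).coeff 0 ∧
      Module.finrank F⟮x⁻¹⟯ K = Module.finrank F⟮x⟯ K := by
  have hintg : IsIntegral F x := .of_finite F x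
  have hintg' : IsIntegral F x⁻¹ := .of_finite F _
  set m := minpoly F x with hm
  have h0 : m.coeff 0 ≠ 0 := minpoly.coeff_zero_ne_zero hintg hx
  have hadj : F⟮x⁻¹⟯ = F⟮x⟯ := by
    apply le_antisymm
    · rw [adjoin_simple_le_iff]; exact inv_mem (mem_adjoin_simple_self F x)
    · rw [adjoin_simple_le_iff]
      have := inv_mem (mem_adjoin_simple_self F x⁻¹)
      rwa [inv_inv] at this
  have hd : (minpoly F x⁻¹).natDegree = m.natDegree := by
    rw [← adjoin.finrank hintg', hadj, adjoin.finrank hintg]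
  have hpos : 0 < m.natDegree := minpoly.natDegree_pos hintg
  have hrn : m.reverse.natDegree = m.natDegree := by
    rw [reverse_natDegree, natTrailingDegree_eq_zero.2 (Or.inr h0), Nat.sub_zero]
  have hpn : (C (m.coeff 0)⁻¹ * m.reverse).natDegree = m.natDegree := by
    rw [natDegree_C_mul (inv_ne_zero h0), hrn]
  have hpm : (C (m.coeff 0)⁻¹ * m.reverse).Monic := by
    rw [Monic, leadingCoeff_mul, leadingCoeff_C, reverse_leadingCoeff, trailingCoeff,
      natTrailingDegree_eq_zero.2 (Or.inr h0)]
    exact inv_mul_cancel₀ h0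
  have hroot : aeval x⁻¹ (C (m.coeff 0)⁻¹ * m.reverse) = 0 := by
    rw [map_mul]
    have : aeval x⁻¹ m.reverse = 0 := by
      letI := invertibleOfNonzero hx
      have := (eval₂_reverse_eq_zero_iff (algebraMap F K) x m).2 (minpoly.aeval F x)
      simpa [aeval_def] using this
    rw [this, mul_zero]
  have hmin : minpoly F x⁻¹ = C (m.coeff 0)⁻¹ * m.reverse := by
    have hdv := minpoly.dvd F _ hroot
    exact (eq_of_monic_of_dvd_of_natDegree_le (minpoly.monic hintg') hpm hdv (by rw [hpn, hd])).symm
  refine ⟨h0, ?_, by rw [hadj]⟩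
  rw [nextCoeff_of_natDegree_pos (by omega), hd, hmin, coeff_C_mul, coeff_reverse]
  rw [show revAt m.natDegree (m.natDegree - 1) = 1 by rw [revAt_le (by omega)]; omega]
  rw [div_eq_mul_inv, mul_comm]

open Polynomial IntermediateField in
lemma klam_minpoly {F K : Type} [Field F] [Field K] [Algebra F K] [FiniteDimensional F K] [DecidableEq F]
    (ψ : AddChar F ℂ) (a b : F) (x : K) (hx : x ≠ 0) :
    ψ (Algebra.trace F K (algebraMap F K a * x + algebraMap F K b * x⁻¹)) =
      klam ψ a b (minpoly F x) ^ (Module.finrank F K / (minpoly F x).natDegree) := by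
  obtain ⟨h0, h1, h2⟩ := minpoly_inv_nextCoeff (F := F) x hx
  have hintg : IsIntegral F x := .of_finite F x
  have h3 : Module.finrank F K / (minpoly F x).natDegree = Module.finrank F⟮x⟯ K := by
    have := Module.finrank_mul_finrank F F⟮x⟯ K
    rw [adjoin.finrank hintg] at this
    rw [← this, Nat.mul_div_cancel_left _ (minpoly.natDegree_pos hintg)]
  rw [h3, klam, if_neg h0, ← AddChar.map_nsmul_eq_pow, map_add, ← Algebra.smul_def, ← Algebra.smul_def,
    map_smul, map_smul, trace_eq_finrank_mul_minpoly_nextCoeff, trace_eq_finrank_mul_minpoly_nextCoeff, h1, h2]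
  congr 1
  simp only [smul_eq_mul, nsmul_eq_mul]
  ring

open Polynomial in
lemma card_fiber_minpoly {F K : Type} [Field F] [Field K] [Algebra F K] [FiniteDimensional F K]
    [Fintype F] [Fintype K] [DecidableEq F] [DecidableEq K] (P : F[X]) (hPm : P.Monic) (hPi : Irreducible P)
    (hdvd : P.natDegree ∣ Module.finrank F K) :
    (Finset.univ.filter (fun x : K => minpoly F x = P)).card = P.natDegree := by
  have hcard : Nat.card F ^ Module.finrank F K = Fintype.card K := by
    rw [Nat.card_eq_fintype_card, ← Module.card_eq_pow_finrank]
  have h1 : P ∣ X ^ Fintype.card K - X := by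
    rw [← hcard]; exact hPi.natDegree_dvd_iff_dvd_X_pow_card_pow_sub_X.1 hdvd
  have h2 : (P.map (algebraMap F K)) ∣ X ^ Fintype.card K - X := by
    have := Polynomial.map_dvd (algebraMap F K) h1
    simpa using this
  have hne : (X ^ Fintype.card K - X : K[X]) ≠ 0 := FiniteField.X_pow_card_sub_X_ne_zero K Fintype.one_lt_card
  have h3 : (X ^ Fintype.card K - X : K[X]).Splits := by
    rw [splits_iff_card_roots, FiniteField.roots_X_pow_card_sub_X,
      FiniteField.X_pow_card_sub_X_natDegree_eq K Fintype.one_lt_card]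
    rfl
  have h4 : (P.map (algebraMap F K)).Splits := h3.of_dvd hne h2
  have hsep : (P.map (algebraMap F K)).Separable := (PerfectField.separable_of_irreducible hPi).map
  have h5 : (Finset.univ.filter (fun x : K => minpoly F x = P)) = (P.map (algebraMap F K)).roots.toFinset := by
    ext x
    rw [Finset.mem_filter, Multiset.mem_toFinset, mem_roots (map_ne_zero hPm.ne_zero), IsRoot.def,
      eval_map_algebraMap]
    constructor
    · rintro ⟨_, rfl⟩; exact minpoly.aeval F x
    · intro h; exact ⟨Finset.mem_univ _, (minpoly.eq_of_irreducible_of_monic hPi h hPm).symm⟩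
  rw [h5, Multiset.toFinset_card_of_nodup (nodup_roots hsep), ← h4.natDegree_eq_card_roots, natDegree_map]

open Polynomial in
lemma Tco_eq {F K : Type} [Field F] [Field K] [Algebra F K] [FiniteDimensional F K]
    [Fintype F] [Fintype K] [DecidableEq F] [DecidableEq K] (ψ : AddChar F ℂ) (a b : F) :
    ∑ x ∈ Finset.univ.filter (fun x : K => x ≠ 0),
      ψ (Algebra.trace F K (algebraMap F K a * x + algebraMap F K b * x⁻¹)) =
    Tco F (klam ψ a b) (Module.finrank F K) := by
  classical
  set j := Module.finrank F K with hj
  have hjpos : 0 < j := Module.finrank_pos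
  have h1 : ∑ x ∈ Finset.univ.filter (fun x : K => x ≠ 0),
      ψ (Algebra.trace F K (algebraMap F K a * x + algebraMap F K b * x⁻¹)) =
      ∑ x : K, klam ψ a b (minpoly F x) ^ (j / (minpoly F x).natDegree) := by
    rw [Finset.sum_filter]
    refine Finset.sum_congr rfl fun x _ => ?_
    split_ifs with hx
    · exact klam_minpoly ψ a b x hx
    · have : x = 0 := by simpa using hx
      rw [this, minpoly.zero, natDegree_X, Nat.div_one, klam, if_pos (by simp), zero_pow hjpos.ne']
  have hdv : ∀ x : K, (minpoly F x).natDegree ∣ j := by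
    intro x; exact minpoly.degree_dvd (.of_finite F x)
  rw [h1, Tco, ← Finset.sum_fiberwise_of_maps_to (g := fun x : K => minpoly F x)
    (t := (irrLE F j).filter (fun P => P.natDegree ∣ j))]
  · refine Finset.sum_congr rfl fun P hP => ?_
    obtain ⟨hP1, hP2⟩ := Finset.mem_filter.1 hP
    obtain ⟨h2, h3, h4⟩ := mem_irrLE.1 hP1
    rw [Finset.sum_congr rfl (g := fun _ => klam ψ a b P ^ (j / P.natDegree))]
    · rw [Finset.sum_const, card_fiber_minpoly P h2 h3 hP2, nsmul_eq_mul]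
    · intro x hx
      rw [(Finset.mem_filter.1 hx).2]
  · intro x _
    have hi : IsIntegral F x := .of_finite F x
    refine Finset.mem_filter.2 ⟨mem_irrLE.2 ⟨minpoly.monic hi, minpoly.irreducible hi, Nat.le_of_dvd hjpos (hdv x)⟩, hdv x⟩

lemma T_rec {F : Type} [Field F] [Fintype F] [DecidableEq F] (ψ : AddChar F ℂ) (hψ : ψ.IsPrimitive)
    (a b : F) (ha : a ≠ 0) (hb : b ≠ 0) (α β : ℂ) (hs : α + β = -kloos ψ a b) (hp : α * β = Fintype.card F)
    (n : ℕ) (hn : 1 ≤ n) : Tco F (klam ψ a b) n = -(α ^ n + β ^ n) := by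
  have hψ1 : ψ ≠ 1 := by
    have := hψ one_ne_zero
    simpa using this
  set q : ℂ := (Fintype.card F : ℂ)
  set s := kloos ψ a b with hs'
  set T := Tco F (klam ψ a b) with hT
  set L := Lco F (klam ψ a b) with hL
  have L0 : L 0 = 1 := klam_L0 ψ a b
  have L1 : L 1 = s := klam_L1 ψ a b
  have L2 : L 2 = q := klam_L2 ψ hψ a b ha hb
  have Ln : ∀ n, 3 ≤ n → L n = 0 := fun n hn => klam_Ln ψ hψ1 a b ha n hn
  have eu : ∀ n : ℕ, (n : ℂ) * L n = ∑ j ∈ Finset.Icc 1 n, T j * L (n - j) :=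
    fun n => euler_identity (klam_one ψ a b) (klam_mul ψ a b) n
  have T1 : T 1 = s := by
    have := eu 1
    simp [L0, L1] at this
    exact this.symm
  have T2 : T 2 = 2 * q - s ^ 2 := by
    have := eu 2
    rw [show Finset.Icc 1 2 = {1, 2} from rfl] at this
    simp [L0, L1, L2, T1] at this
    linear_combination -this
  have T3 : ∀ n, 1 ≤ n → T (n + 2) = - s * T (n + 1) - q * T n := by
    intro n hn
    obtain ⟨m, rfl⟩ : ∃ m, n = m + 1 := ⟨n - 1, by omega⟩
    have := eu (m + 1 + 2)
    rw [Ln (m + 1 + 2) (by omega), mul_zero, Finset.sum_Icc_succ_top (by omega),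
      Finset.sum_Icc_succ_top (by omega), Finset.sum_Icc_succ_top (by omega),
      Finset.sum_eq_zero] at this
    · rw [show m + 1 + 2 - (m + 1) = 2 by omega, show m + 1 + 2 - (m + 1 + 1) = 1 by omega,
        show m + 1 + 2 - (m + 1 + 1 + 1) = 0 by omega, L0, L1, L2] at this
      linear_combination -this
    · intro j hj
      rw [Finset.mem_Icc] at hj
      rw [Ln _ (by omega), mul_zero]
  induction n using Nat.strong_induction_on with
  | _ n ih =>
    match n, hn with
    | 1, _ => rw [T1]; linear_combination hs
    | 2, _ => rw [T2]; linear_combination (-s + α + β) * hs - 2 * hp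
    | n + 3, _ =>
      rw [T3 (n + 1) (by omega), ih (n + 2) (by omega) (by omega), ih (n + 1) (by omega) (by omega)]
      have e1 : s = -(α + β) := by rw [hs, neg_neg]
      rw [e1, ← hp]; ring

lemma kloos_real {F : Type} [Field F] [Fintype F] [DecidableEq F] (ψ : AddChar F ℂ) (a b : F) :
    ∃ s : ℝ, kloos ψ a b = s := by
  refine ⟨(kloos ψ a b).re, ?_⟩
  symm
  rw [← Complex.conj_eq_iff_re, kloos, map_sum, Finset.sum_filter, Finset.sum_filter,
    ← Equiv.sum_comp (Equiv.neg F)]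
  refine Finset.sum_congr rfl fun x _ => ?_
  simp only [Equiv.neg_apply, ne_eq, neg_eq_zero, inv_neg]
  split_ifs
  · rfl
  · rw [← AddChar.map_neg_eq_conj]; congr 1; ring

lemma S_sum {F K : Type} [Field F] [Field K] [Algebra F K] [FiniteDimensional F K]
    [Fintype F] [Fintype K] [DecidableEq F] [DecidableEq K] (ψ : AddChar F ℂ) (hψ : ψ.IsPrimitive) (a b : F) :
    ∑ c ∈ Finset.univ.filter (fun c : F => c ≠ 0), Tco F (klam ψ (c * a) (c * b)) (Module.finrank F K) =
    (Fintype.card F : ℂ) * ((Finset.univ.filter (fun x : K => x ≠ 0 ∧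
      Algebra.trace F K (algebraMap F K a * x + algebraMap F K b * x⁻¹) = 0)).card : ℂ) -
      ((Fintype.card K : ℂ) - 1) := by
  simp only [← Tco_eq (K := K)]
  rw [Finset.sum_comm]
  have h1 : ∀ x : K, ∑ c ∈ Finset.univ.filter (fun c : F => c ≠ 0),
      ψ (Algebra.trace F K (algebraMap F K (c * a) * x + algebraMap F K (c * b) * x⁻¹)) =
      (if Algebra.trace F K (algebraMap F K a * x + algebraMap F K b * x⁻¹) = 0 then (Fintype.card F : ℂ) else 0) - 1 := by
    intro x
    have e : ∀ c : F, Algebra.trace F K (algebraMap F K (c * a) * x + algebraMap F K (c * b) * x⁻¹) =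
        c * Algebra.trace F K (algebraMap F K a * x + algebraMap F K b * x⁻¹) := by
      intro c
      have h := (Algebra.trace F K).map_smul c (algebraMap F K a * x + algebraMap F K b * x⁻¹)
      rw [smul_eq_mul, Algebra.smul_def] at h
      rw [← h, map_mul, map_mul]
      congr 1; ring
    simp only [e]
    have h := AddChar.sum_mulShift (Algebra.trace F K (algebraMap F K a * x + algebraMap F K b * x⁻¹)) hψ
    rw [← Finset.sum_filter_add_sum_filter_not _ (fun c : F => c ≠ 0)] at h
    have h' : Finset.univ.filter (fun c : F => ¬ (c ≠ 0)) = {0} := by ext; simp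
    rw [h', Finset.sum_singleton, zero_mul, AddChar.map_zero_eq_one] at h
    rw [eq_sub_iff_add_eq, h]
    push_cast; rfl
  rw [Finset.sum_congr rfl (fun x _ => h1 x), Finset.sum_sub_distrib, ← Finset.sum_filter, Finset.filter_filter,
    Finset.sum_const, Finset.sum_const, Finset.filter_ne', Finset.card_erase_of_mem (Finset.mem_univ _),
    Finset.card_univ, nsmul_eq_mul, nsmul_eq_mul, Nat.cast_sub Fintype.card_pos]
  push_cast; ring

/-- either small or negative -/
lemma T_even {F : Type} [Field F] [Fintype F] [DecidableEq F] (ψ : AddChar F ℂ) (hψ : ψ.IsPrimitive)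
    (a b : F) (ha : a ≠ 0) (hb : b ≠ 0) (s : ℝ) (hs : kloos ψ a b = s) (n : ℕ) (hn : 1 ≤ n) :
    (s ^ 2 ≤ 4 * Fintype.card F → (Tco F (klam ψ a b) (2 * n)).re ≤ 2 * (Fintype.card F : ℝ) ^ n) ∧
    (4 * Fintype.card F < s ^ 2 → (Tco F (klam ψ a b) (2 * n)).re ≤ -(s ^ 2 / 4) ^ n) := by
  set q : ℝ := (Fintype.card F : ℝ) with hq
  constructor
  · intro h
    set r := Real.sqrt (4 * q - s ^ 2) with hr
    have hr2 : r ^ 2 = 4 * q - s ^ 2 := Real.sq_sqrt (by linarith)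
    have hr2' : (r : ℂ) ^ 2 = 4 * q - s ^ 2 := by exact_mod_cast congrArg (Complex.ofReal) hr2
    set α : ℂ := (-s + r * Complex.I) / 2 with hα
    set β : ℂ := (-s - r * Complex.I) / 2 with hβ
    have hprod : α * β = (q : ℂ) := by
      rw [hα, hβ]; linear_combination (1 / 4) * hr2' - (r:ℂ)^2/4 * Complex.I_sq
    have hαn : ‖α‖ ^ 2 = q := by
      rw [← Complex.normSq_eq_norm_sq, Complex.normSq_apply]
      simp [hα]; linarith
    have hβn : ‖β‖ ^ 2 = q := by
      rw [← Complex.normSq_eq_norm_sq, Complex.normSq_apply]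
      simp [hβ]; linarith
    rw [T_rec ψ hψ a b ha hb α β (by rw [hs, hα, hβ]; ring) (by rw [hprod, hq]; simp) (2 * n) (by omega)]
    refine (Complex.re_le_norm _).trans ?_
    rw [norm_neg]
    refine (norm_add_le _ _).trans ?_
    rw [norm_pow, norm_pow, pow_mul, pow_mul, hαn, hβn]; linarith
  · intro h
    set r := Real.sqrt (s ^ 2 - 4 * q) with hr
    have hr2 : r ^ 2 = s ^ 2 - 4 * q := Real.sq_sqrt (by linarith)
    have hr0 : 0 ≤ r := Real.sqrt_nonneg _
    set α : ℝ := (-s + r) / 2 with hα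
    set β : ℝ := (-s - r) / 2 with hβ
    have hprod : α * β = q := by rw [hα, hβ]; linarith
    have key : Tco F (klam ψ a b) (2 * n) = ((-(α ^ (2 * n) + β ^ (2 * n)) : ℝ) : ℂ) := by
      rw [T_rec ψ hψ a b ha hb α β (by rw [hs]; rw [← Complex.ofReal_add, ← Complex.ofReal_neg]; congr 1; rw [hα, hβ]; ring)
        (by rw [← Complex.ofReal_mul, hprod, hq]; simp) (2 * n) (by omega)]
      push_cast; ring
    rw [key, Complex.ofReal_re, neg_le_neg_iff, pow_mul, pow_mul]
    rcases le_total 0 s with h0 | h0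
    · have : s ^ 2 / 4 ≤ β ^ 2 := by rw [hβ]; nlinarith [mul_nonneg h0 hr0]
      have := pow_le_pow_left₀ (by positivity) this n
      have : 0 ≤ (α ^ 2) ^ n := by positivity
      linarith
    · have : s ^ 2 / 4 ≤ α ^ 2 := by rw [hα]; nlinarith [mul_nonneg (neg_nonneg.2 h0) hr0]
      have := pow_le_pow_left₀ (by positivity) this n
      have : 0 ≤ (β ^ 2) ^ n := by positivity
      linarith

lemma weil_sum {F : Type} [Field F] [Fintype F] [DecidableEq F] (hodd : Odd (Fintype.card F))
    (ψ : AddChar F ℂ) (hψ : ψ.IsPrimitive)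
    (a b : F) (ha : a ≠ 0) (hb : b ≠ 0) (n : ℕ) (hn : 1 ≤ n)
    (hlarge : 2 * Fintype.card F + 3 ≤ Fintype.card F ^ n) :
    -((10 * (Fintype.card F : ℝ) + 3) * (Fintype.card F : ℝ) ^ n) ≤
      ∑ c ∈ Finset.univ.filter (fun c : F => c ≠ 0), (Tco F (klam ψ (c * a) (c * b)) (2 * n)).re := by
  classical
  obtain ⟨p, hp⟩ := CharP.exists F
  haveI : Fact p.Prime := ⟨CharP.char_is_prime F p⟩
  haveI : NeZero (2 * n) := ⟨by omega⟩
  letI : Fintype (FiniteField.Extension F p (2 * n)) := Fintype.ofFinite _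
  set K := FiniteField.Extension F p (2 * n) with hK
  have hfr : Module.finrank F K = 2 * n := FiniteField.finrank_extension F p (2 * n)
  have hcard : Fintype.card K = (Fintype.card F ^ n) ^ 2 := by
    rw [Module.card_eq_pow_finrank (K := F), hfr, ← pow_mul, mul_comm]
  have h1 := pointcount (F := F) (K := K) n hfr hodd a b ha hb hlarge
  have h2 := S_sum (F := F) (K := K) ψ hψ a b
  rw [hfr] at h2
  have h3 := congrArg Complex.re h2
  rw [Complex.re_sum] at h3
  rw [h3, hcard]
  set N := (Finset.univ.filter (fun x : K => x ≠ 0 ∧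
      Algebra.trace F K (algebraMap F K a * x + algebraMap F K b * x⁻¹) = 0)).card
  have h4 : (((Fintype.card F ^ n) ^ 2 : ℕ) : ℝ) ≤ ((Fintype.card F * N + (10 * Fintype.card F + 3) * Fintype.card F ^ n : ℕ) : ℝ) := by
    exact_mod_cast h1
  push_cast at h4
  have e : ((Fintype.card F : ℂ) * (N : ℂ) - ((((Fintype.card F ^ n) ^ 2 : ℕ) : ℂ) - 1)) =
    (((Fintype.card F : ℝ) * (N : ℝ) - (((Fintype.card F : ℝ) ^ n) ^ 2 - 1) : ℝ) : ℂ) := by push_cast; ring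
  rw [e, Complex.ofReal_re]
  linarith

theorem weil_kloosterman {F : Type} [Field F] [Fintype F] [DecidableEq F] (hodd : Odd (Fintype.card F))
    (ψ : AddChar F ℂ) (hψ : ψ.IsPrimitive) (a b : F) (ha : a ≠ 0) (hb : b ≠ 0) :
    ‖kloos ψ a b‖ ≤ 2 * Real.sqrt (Fintype.card F) := by
  obtain ⟨s, hs⟩ := kloos_real ψ a b
  have hq2 : 1 < Fintype.card F := Fintype.one_lt_card
  set q : ℝ := (Fintype.card F : ℝ) with hq
  have hq1 : (1 : ℝ) < q := by rw [hq]; exact_mod_cast hq2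
  rw [hs, Complex.norm_real, Real.norm_eq_abs]
  suffices h : s ^ 2 ≤ 4 * q by
    rw [← Real.sqrt_sq_eq_abs]
    calc Real.sqrt (s ^ 2) ≤ Real.sqrt (2 ^ 2 * q) := Real.sqrt_le_sqrt (by linarith)
      _ = 2 * Real.sqrt q := by rw [Real.sqrt_mul (by norm_num), Real.sqrt_sq (by norm_num)]
  by_contra hlt
  push Not at hlt
  have main : ∀ n : ℕ, 1 ≤ n → 2 * Fintype.card F + 3 ≤ Fintype.card F ^ n →
      (s ^ 2 / 4) ^ n ≤ (12 * q + 3) * q ^ n := by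
    intro n hn hl
    have h1 := weil_sum hodd ψ hψ a b ha hb n hn hl
    rw [← Finset.add_sum_erase _ _ (Finset.mem_filter.2 ⟨Finset.mem_univ (1:F), one_ne_zero⟩)] at h1
    have h2 := (T_even ψ hψ (1 * a) (1 * b) (by simpa) (by simpa) s (by simpa using hs) n hn).2 hlt
    have h3 : ∑ c ∈ (Finset.univ.filter (fun c : F => c ≠ 0)).erase 1, (Tco F (klam ψ (c * a) (c * b)) (2 * n)).re
        ≤ ∑ c ∈ (Finset.univ.filter (fun c : F => c ≠ 0)).erase 1, 2 * q ^ n := by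
      refine Finset.sum_le_sum fun c hc => ?_
      have hc0 : c ≠ 0 := (Finset.mem_filter.1 (Finset.mem_erase.1 hc).2).2
      obtain ⟨s', hs'⟩ := kloos_real ψ (c * a) (c * b)
      have h4 := T_even ψ hψ (c * a) (c * b) (mul_ne_zero hc0 ha) (mul_ne_zero hc0 hb) s' hs' n hn
      rcases le_or_gt (s' ^ 2) (4 * (Fintype.card F : ℝ)) with h5 | h5
      · exact h4.1 h5
      · refine (h4.2 h5).trans ?_
        have : 0 ≤ (s' ^ 2 / 4) ^ n := by positivity
        have : 0 ≤ q ^ n := by positivity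
        linarith
    rw [Finset.sum_const, nsmul_eq_mul] at h3
    have h5 : (((Finset.univ.filter (fun c : F => c ≠ 0)).erase 1).card : ℝ) ≤ q := by
      rw [hq]; exact_mod_cast Finset.card_le_univ _
    have h6 : 0 ≤ 2 * q ^ n := by positivity
    have h7 := mul_le_mul_of_nonneg_right h5 h6
    nlinarith
  set ρ := s ^ 2 / 4 / q with hρ
  have hρ1 : 1 < ρ := by rw [hρ, lt_div_iff₀ (by linarith)]; linarith
  obtain ⟨m, hm⟩ := pow_unbounded_of_one_lt (12 * q + 3) hρ1
  obtain ⟨m', hm'⟩ := pow_unbounded_of_one_lt (2 * Fintype.card F + 3) hq2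
  set n := max 1 (max m m') with hn
  have h1 := main n (le_max_left _ _) (hm'.le.trans (Nat.pow_le_pow_right (by omega) ((le_max_right _ _).trans (le_max_right _ _))))
  have h2 : ρ ^ m ≤ ρ ^ n := pow_le_pow_right₀ hρ1.le ((le_max_left _ _).trans (le_max_right _ _))
  have h3 : (s ^ 2 / 4) ^ n = ρ ^ n * q ^ n := by
    rw [← mul_pow, hρ, div_mul_cancel₀ _ (by linarith)]
  rw [h3] at h1
  have h4 := le_of_mul_le_mul_right h1 (by positivity)
  linarith

/-- quadratic Gauss sum -/
noncomputable def Qs {F : Type} [Field F] [Fintype F] (ψ : AddChar F ℂ) (t : F) : ℂ := ∑ x : F, ψ (t * x ^ 2)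

lemma sum_ψ {F : Type} [Field F] [Fintype F] [DecidableEq F] (ψ : AddChar F ℂ) (hψ : ψ.IsPrimitive) (c : F) :
    ∑ x : F, ψ (c * x) = if c = 0 then (Fintype.card F : ℂ) else 0 := by
  have := AddChar.sum_mulShift c hψ
  simp only [mul_comm _ c] at this
  rw [this]; push_cast; rfl

lemma Qs_eq {F : Type} [Field F] [Fintype F] [DecidableEq F] (hF : ringChar F ≠ 2) (ψ : AddChar F ℂ)
    (hψ : ψ.IsPrimitive) (t : F) (ht : t ≠ 0) :
    Qs ψ t = ((quadraticChar F t : ℤ) : ℂ) * Qs ψ 1 := by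
  have h1 : ∀ s : F, s ≠ 0 → Qs ψ s = ∑ y : F, ((quadraticChar F y : ℤ) : ℂ) * ψ (s * y) := by
    intro s hs
    have : Qs ψ s = ∑ y : F, (((quadraticChar F y : ℤ) : ℂ) + 1) * ψ (s * y) := by
      rw [Qs, ← Finset.sum_fiberwise_of_maps_to (g := fun x : F => x ^ 2) (t := Finset.univ) (fun _ _ => Finset.mem_univ _)]
      refine Finset.sum_congr rfl fun y _ => ?_
      rw [Finset.sum_congr rfl (g := fun _ => ψ (s * y))]
      · rw [Finset.sum_const, nsmul_eq_mul]
        congr 1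
        have h := quadraticChar_card_sqrts hF y
        have h' : {x : F | x ^ 2 = y}.toFinset = Finset.univ.filter (fun x : F => x ^ 2 = y) := by
          ext; simp
        rw [h'] at h
        exact_mod_cast congrArg (Int.cast : ℤ → ℂ) h
      · intro x hx
        rw [(Finset.mem_filter.1 hx).2]
    rw [this]
    simp only [add_mul, one_mul]
    rw [Finset.sum_add_distrib, sum_ψ ψ hψ, if_neg hs, add_zero]
  rw [h1 t ht, h1 1 one_ne_zero, Finset.mul_sum, ← Equiv.sum_comp (Equiv.mulLeft₀ t⁻¹ (inv_ne_zero ht))]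
  refine Finset.sum_congr rfl fun y _ => ?_
  simp only [Equiv.mulLeft₀_apply, map_mul, one_mul]
  rw [mul_inv_cancel_left₀ ht]
  have h2 : quadraticChar F t⁻¹ = quadraticChar F t := by
    have e : quadraticChar F t⁻¹ * quadraticChar F t = 1 := by rw [← map_mul, inv_mul_cancel₀ ht, map_one]
    have e2 : quadraticChar F t ^ 2 = 1 := quadraticChar_sq_one ht
    calc quadraticChar F t⁻¹ = quadraticChar F t⁻¹ * quadraticChar F t ^ 2 := by rw [e2, mul_one]
      _ = (quadraticChar F t⁻¹ * quadraticChar F t) * quadraticChar F t := by ring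
      _ = _ := by rw [e, one_mul]
  rw [h2]; push_cast; ring

lemma Qs_norm {F : Type} [Field F] [Fintype F] [DecidableEq F] (hF : ringChar F ≠ 2) (ψ : AddChar F ℂ)
    (hψ : ψ.IsPrimitive) : ‖Qs ψ 1‖ ^ 2 = Fintype.card F := by
  have h2 : (2 : F) ≠ 0 := Ring.two_ne_zero hF
  have : ((‖Qs ψ 1‖ ^ 2 : ℝ) : ℂ) = (Fintype.card F : ℂ) := by
    rw [Complex.ofReal_pow, ← Complex.mul_conj', Qs, map_sum, Finset.sum_mul_sum, Finset.sum_comm]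
    have : ∀ y : F, ∑ x : F, ψ (1 * x ^ 2) * (starRingEnd ℂ) (ψ (1 * y ^ 2)) =
        ∑ u : F, ψ (u ^ 2) * ψ ((2 * u) * y) := by
      intro y
      rw [← Equiv.sum_comp (Equiv.addRight y)]
      refine Finset.sum_congr rfl fun u _ => ?_
      rw [← AddChar.map_neg_eq_conj, ← AddChar.map_add_eq_mul, ← AddChar.map_add_eq_mul]
      congr 1
      simp; ring
    rw [Finset.sum_congr rfl fun y _ => this y, Finset.sum_comm]
    simp only [← Finset.mul_sum]
    rw [Finset.sum_eq_single 0]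
    · rw [sum_ψ ψ hψ]; simp
    · intro u _ hu
      rw [sum_ψ ψ hψ, if_neg (mul_ne_zero h2 hu), mul_zero]
    · simp
  exact_mod_cast this

lemma Qs_complete {F : Type} [Field F] [Fintype F] [DecidableEq F] (hF : ringChar F ≠ 2) (ψ : AddChar F ℂ)
    (t m : F) (ht : t ≠ 0) :
    ∑ x : F, ψ (t * x ^ 2 + m * x) = Qs ψ t * ψ (-(m ^ 2 / 4) * t⁻¹) := by
  have h2 : (2 : F) ≠ 0 := Ring.two_ne_zero hF
  have h4 : (4 : F) ≠ 0 := by rw [show (4:F) = 2 * 2 by norm_num]; exact mul_ne_zero h2 h2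
  rw [Qs, Finset.sum_mul, ← Equiv.sum_comp (Equiv.addRight (-(m / (2 * t))))]
  refine Finset.sum_congr rfl fun x _ => ?_
  rw [← AddChar.map_add_eq_mul]
  congr 1
  simp only [Equiv.coe_addRight]
  field_simp
  ring

lemma salie {F : Type} [Field F] [Fintype F] [DecidableEq F] (hF : ringChar F ≠ 2) (ψ : AddChar F ℂ)
    (hψ : ψ.IsPrimitive) (M : F) :
    ‖∑ t ∈ Finset.univ.filter (fun t : F => t ≠ 0), ((quadraticChar F t : ℤ) : ℂ) * ψ (-t + -M * t⁻¹)‖ ≤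
      2 * Real.sqrt (Fintype.card F) := by
  have h2 : (2 : F) ≠ 0 := Ring.two_ne_zero hF
  have h4 : (4 : F) ≠ 0 := by rw [show (4:F) = 2 * 2 by norm_num]; exact mul_ne_zero h2 h2
  set S := ∑ t ∈ Finset.univ.filter (fun t : F => t ≠ 0), ((quadraticChar F t : ℤ) : ℂ) * ψ (-t + -M * t⁻¹) with hS
  by_cases hM : IsSquare M
  · obtain ⟨c, rfl⟩ := hM
    have key : Qs ψ 1 * S = (Fintype.card F : ℂ) * (ψ (2 * c) + ψ (-(2 * c))) - if c = 0 then (Fintype.card F : ℂ) else 0 := by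
      have e1 : ∀ t ∈ Finset.univ.filter (fun t : F => t ≠ 0),
          Qs ψ 1 * (((quadraticChar F t : ℤ) : ℂ) * ψ (-t + -(c * c) * t⁻¹)) =
          ∑ x : F, ψ ((x ^ 2 - 1) * t) * ψ (2 * c * x) := by
        intro t ht
        have ht0 := (Finset.mem_filter.1 ht).2
        rw [← mul_assoc, mul_comm (Qs ψ 1), ← Qs_eq hF ψ hψ t ht0, AddChar.map_add_eq_mul, mul_left_comm]
        have := Qs_complete hF ψ t (2 * c) ht0
        rw [show -((2 * c) ^ 2 / 4) = -(c * c) by field_simp; ring] at this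
        rw [← this, Finset.mul_sum]
        refine Finset.sum_congr rfl fun x _ => ?_
        rw [← AddChar.map_add_eq_mul, ← AddChar.map_add_eq_mul]
        congr 1; ring
      rw [hS, Finset.mul_sum, Finset.sum_congr rfl e1, Finset.sum_comm]
      simp only [← Finset.sum_mul]
      have e2 : ∀ x : F, ∑ t ∈ Finset.univ.filter (fun t : F => t ≠ 0), ψ ((x ^ 2 - 1) * t) =
          (if x ^ 2 - 1 = 0 then (Fintype.card F : ℂ) else 0) - 1 := by
        intro x
        have h := sum_ψ ψ hψ (x ^ 2 - 1)
        rw [← Finset.sum_filter_add_sum_filter_not _ (fun c : F => c ≠ 0)] at h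
        have h' : Finset.univ.filter (fun c : F => ¬ (c ≠ 0)) = {0} := by ext; simp
        rw [h', Finset.sum_singleton, mul_zero, AddChar.map_zero_eq_one] at h
        rw [eq_sub_iff_add_eq, h]
      simp only [e2]
      simp only [sub_mul _ (1 : ℂ), one_mul, Finset.sum_sub_distrib]
      rw [sum_ψ ψ hψ]
      have e3 : (2 * c = 0) ↔ c = 0 := by simp [h2]
      simp only [e3]
      congr 1
      simp only [ite_mul, zero_mul]
      rw [← Finset.sum_filter]
      have e4 : Finset.univ.filter (fun x : F => x ^ 2 - 1 = 0) = {1, -1} := by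
        ext x
        simp [sub_eq_zero]
      have e5 : (1 : F) ≠ -1 := by
        intro h
        exact h2 (by linear_combination h)
      rw [e4, Finset.sum_pair e5]
      simp only [mul_one, mul_neg]; ring
    have hb : ‖Qs ψ 1‖ * ‖S‖ ≤ 2 * Fintype.card F := by
      rw [← norm_mul, key]
      split_ifs with hc
      · subst hc
        simp
        rw [show (Fintype.card F : ℂ) * (1 + 1) - Fintype.card F = Fintype.card F by ring]
        simp
        linarith [(Nat.cast_nonneg (Fintype.card F) : (0:ℝ) ≤ _)]
      · rw [sub_zero, norm_mul, Complex.norm_natCast]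
        have := norm_add_le (ψ (2 * c)) (ψ (-(2 * c)))
        rw [AddChar.norm_apply, AddChar.norm_apply] at this
        nlinarith [(Nat.cast_nonneg (Fintype.card F) : (0:ℝ) ≤ _)]
    have hn := Qs_norm hF ψ hψ
    have hn' : ‖Qs ψ 1‖ = Real.sqrt (Fintype.card F) := by
      rw [← hn, Real.sqrt_sq (norm_nonneg _)]
    rw [hn'] at hb
    have hpos : 0 < Real.sqrt (Fintype.card F) := Real.sqrt_pos.2 (by exact_mod_cast Fintype.card_pos)
    have hsq : Real.sqrt (Fintype.card F) * Real.sqrt (Fintype.card F) = Fintype.card F :=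
      Real.mul_self_sqrt (by positivity)
    refine le_of_mul_le_mul_left ?_ hpos
    linarith
  · have hM0 : M ≠ 0 := by rintro rfl; exact hM (by simp)
    have hη : quadraticChar F M = -1 := (quadraticChar_neg_one_iff_not_isSquare).2 hM
    have : S = -S := by
      conv_lhs => rw [hS]
      rw [hS, ← Finset.sum_neg_distrib]
      refine Finset.sum_nbij' (fun t => M * t⁻¹) (fun t => M * t⁻¹) ?_ ?_ ?_ ?_ ?_
      · intro t ht; simp at ht ⊢; exact ⟨hM0, ht⟩
      · intro t ht; simp at ht ⊢; exact ⟨hM0, ht⟩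
      · intro t ht; simp at ht; field_simp
      · intro t ht; simp at ht; field_simp
      · intro t ht
        simp at ht
        have h3 : quadraticChar F t⁻¹ = quadraticChar F t := by
          have e : quadraticChar F t⁻¹ * quadraticChar F t = 1 := by rw [← map_mul, inv_mul_cancel₀ ht, map_one]
          have e2 : quadraticChar F t ^ 2 = 1 := quadraticChar_sq_one ht
          calc quadraticChar F t⁻¹ = quadraticChar F t⁻¹ * quadraticChar F t ^ 2 := by rw [e2, mul_one]
            _ = (quadraticChar F t⁻¹ * quadraticChar F t) * quadraticChar F t := by ring
            _ = _ := by rw [e, one_mul]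
        rw [map_mul, hη, h3]
        push_cast
        rw [show -(M * t⁻¹) + -M * (M * t⁻¹)⁻¹ = -t + -M * t⁻¹ by field_simp; ring]
        ring
    have hS0 : S = 0 := by
      have : (2 : ℂ) * S = 0 := by linear_combination this
      simpa using this
    rw [hS0, norm_zero]; positivity

lemma kl_even {F : Type} [Field F] [Fintype F] [DecidableEq F] (hodd : Odd (Fintype.card F)) (ψ : AddChar F ℂ)
    (hψ : ψ.IsPrimitive) (M : F) :
    ‖∑ t ∈ Finset.univ.filter (fun t : F => t ≠ 0), ψ (-t + -M * t⁻¹)‖ ≤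
      2 * Real.sqrt (Fintype.card F) := by
  by_cases hM : M = 0
  · subst hM
    have h := sum_ψ ψ hψ (-1)
    rw [← Finset.sum_filter_add_sum_filter_not _ (fun c : F => c ≠ 0)] at h
    have h' : Finset.univ.filter (fun c : F => ¬ (c ≠ 0)) = {0} := by ext; simp
    rw [h', Finset.sum_singleton, mul_zero, AddChar.map_zero_eq_one, if_neg (by simp)] at h
    simp only [neg_zero, zero_mul, add_zero]
    simp only [neg_one_mul] at h
    rw [eq_neg_of_add_eq_zero_left h]
    simp
    have : 1 ≤ Real.sqrt (Fintype.card F) := by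
      rw [Real.one_le_sqrt]; exact_mod_cast Fintype.card_pos
    linarith
  · have := weil_kloosterman hodd ψ hψ (-1) (-M) (by simp) (by simpa)
    rw [kloos] at this
    simpa only [neg_one_mul] using this

lemma prod_sum_ψ {F : Type} [Field F] [Fintype F] {d : ℕ} (f : Fin d → F → ℂ) :
    ∑ x : Fin d → F, ∏ i, f i (x i) = ∏ i, ∑ a : F, f i a := by
  classical
  rw [Finset.prod_univ_sum, Fintype.piFinset_univ]

lemma ψ_sum {F : Type} [Field F] {d : ℕ} (ψ : AddChar F ℂ) (f : Fin d → F) :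
    ψ (∑ i, f i) = ∏ i, ψ (f i) := by
  classical
  have : ∀ s : Finset (Fin d), ψ (∑ i ∈ s, f i) = ∏ i ∈ s, ψ (f i) := by
    intro s
    induction s using Finset.induction_on with
    | empty => simp
    | insert a s ha ih => rw [Finset.sum_insert ha, Finset.prod_insert ha, AddChar.map_add_eq_mul, ih]
  exact this Finset.univ

/-- balanced unit sphere indicator -/
noncomputable def hfun {F : Type} [Field F] [Fintype F] [DecidableEq F] {d : ℕ} (z : Fin d → F) : ℂ :=
  (if ∑ j, z j ^ 2 = 1 then 1 else 0) - (Fintype.card F : ℂ)⁻¹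

lemma hfun_eq {F : Type} [Field F] [Fintype F] [DecidableEq F] {d : ℕ} (ψ : AddChar F ℂ) (hψ : ψ.IsPrimitive)
    (z : Fin d → F) : hfun z = (Fintype.card F : ℂ)⁻¹ *
      ∑ t ∈ Finset.univ.filter (fun t : F => t ≠ 0), ψ (-t) * ∏ j, ψ (t * z j ^ 2) := by
  have hq : (Fintype.card F : ℂ) ≠ 0 := by exact_mod_cast Fintype.card_ne_zero
  have h := sum_ψ ψ hψ (∑ j, z j ^ 2 - 1)
  rw [← Finset.sum_filter_add_sum_filter_not _ (fun c : F => c ≠ 0)] at h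
  have h' : Finset.univ.filter (fun c : F => ¬ (c ≠ 0)) = {0} := by ext; simp
  rw [h', Finset.sum_singleton, mul_zero, AddChar.map_zero_eq_one, ← eq_sub_iff_add_eq] at h
  have e : ∀ t : F, ψ (-t) * ∏ j, ψ (t * z j ^ 2) = ψ ((∑ j, z j ^ 2 - 1) * t) := by
    intro t
    rw [← ψ_sum, ← AddChar.map_add_eq_mul, ← Finset.mul_sum]
    congr 1; ring
  simp only [e]
  rw [h, hfun]
  simp only [sub_eq_zero]
  split_ifs
  · field_simp
  · field_simp; ring

lemma hhat_eq {F : Type} [Field F] [Fintype F] [DecidableEq F] (hF : ringChar F ≠ 2) {d : ℕ} (ψ : AddChar F ℂ)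
    (hψ : ψ.IsPrimitive) (m : Fin d → F) :
    ∑ z : Fin d → F, hfun z * ψ (∑ j, m j * z j) = (Fintype.card F : ℂ)⁻¹ * (Qs ψ 1 ^ d *
      ∑ t ∈ Finset.univ.filter (fun t : F => t ≠ 0), ((quadraticChar F t : ℤ) : ℂ) ^ d *
        ψ (-t + -((∑ j, m j ^ 2) / 4) * t⁻¹)) := by
  simp only [hfun_eq ψ hψ, mul_assoc, Finset.sum_mul, Finset.mul_sum]
  rw [Finset.sum_comm]
  refine Finset.sum_congr rfl fun t ht => ?_
  have ht0 := (Finset.mem_filter.1 ht).2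
  rw [← Finset.mul_sum, ← Finset.mul_sum]
  congr 1
  have e : ∀ z : Fin d → F, (∏ j, ψ (t * z j ^ 2)) * ψ (∑ j, m j * z j) = ∏ j, ψ (t * z j ^ 2 + m j * z j) := by
    intro z
    rw [ψ_sum, ← Finset.prod_mul_distrib]
    simp only [AddChar.map_add_eq_mul]
  simp only [e]
  rw [prod_sum_ψ (fun j x => ψ (t * x ^ 2 + m j * x))]
  simp only [Qs_complete hF ψ t _ ht0]
  rw [Finset.prod_mul_distrib, Finset.prod_const, Finset.card_univ, Fintype.card_fin, ← ψ_sum,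
    Qs_eq hF ψ hψ t ht0, mul_pow, AddChar.map_add_eq_mul, ← Finset.sum_mul, Finset.sum_neg_distrib, Finset.sum_div]
  ring

lemma hhat_bound {F : Type} [Field F] [Fintype F] [DecidableEq F] (hodd : Odd (Fintype.card F)) {d : ℕ} (ψ : AddChar F ℂ)
    (hψ : ψ.IsPrimitive) (m : Fin d → F) :
    ‖∑ z : Fin d → F, hfun z * ψ (∑ j, m j * z j)‖ ≤ 2 * (Fintype.card F : ℝ) ^ (((d : ℝ) - 1) / 2) := by
  have hF : ringChar F ≠ 2 := by
    intro h
    have := FiniteField.even_card_of_char_two h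
    rw [Nat.odd_iff] at hodd
    omega
  have hq0 : (0 : ℝ) < Fintype.card F := by exact_mod_cast Fintype.card_pos
  rw [hhat_eq hF ψ hψ]
  set S := ∑ t ∈ Finset.univ.filter (fun t : F => t ≠ 0), ((quadraticChar F t : ℤ) : ℂ) ^ d *
        ψ (-t + -((∑ j, m j ^ 2) / 4) * t⁻¹) with hS
  have hSb : ‖S‖ ≤ 2 * Real.sqrt (Fintype.card F) := by
    rcases Nat.even_or_odd d with ⟨e, he⟩ | ⟨e, he⟩
    · refine le_trans (le_of_eq ?_) (kl_even hodd ψ hψ ((∑ j, m j ^ 2) / 4))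
      rw [hS]
      congr 1
      refine Finset.sum_congr rfl fun t ht => ?_
      have h2 : quadraticChar F t ^ d = 1 := by
        rw [he, ← two_mul, pow_mul, quadraticChar_sq_one (Finset.mem_filter.1 ht).2, one_pow]
      have h3 : ((quadraticChar F t : ℤ) : ℂ) ^ d = 1 := by exact_mod_cast congrArg (Int.cast : ℤ → ℂ) h2
      rw [h3, one_mul]
    · refine le_trans (le_of_eq ?_) (salie hF ψ hψ ((∑ j, m j ^ 2) / 4))
      rw [hS]
      congr 1
      refine Finset.sum_congr rfl fun t ht => ?_
      have h2 : quadraticChar F t ^ d = quadraticChar F t := by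
        rw [he, pow_succ, pow_mul, quadraticChar_sq_one (Finset.mem_filter.1 ht).2, one_pow, one_mul]
      have h3 : ((quadraticChar F t : ℤ) : ℂ) ^ d = ((quadraticChar F t : ℤ) : ℂ) := by
        exact_mod_cast congrArg (Int.cast : ℤ → ℂ) h2
      rw [h3]
  have hn' : ‖Qs ψ 1‖ = Real.sqrt (Fintype.card F) := by
    rw [← Qs_norm hF ψ hψ, Real.sqrt_sq (norm_nonneg _)]
  rw [norm_mul, norm_mul, norm_pow, hn', norm_inv, Complex.norm_natCast]
  set q : ℝ := (Fintype.card F : ℝ)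
  calc q⁻¹ * (Real.sqrt q ^ d * ‖S‖) ≤ q⁻¹ * (Real.sqrt q ^ d * (2 * Real.sqrt q)) := by gcongr
    _ = 2 * q ^ (((d : ℝ) - 1) / 2) := by
      rw [Real.sqrt_eq_rpow, ← Real.rpow_natCast, ← Real.rpow_mul hq0.le, ← Real.rpow_neg_one]
      rw [show q ^ (-1 : ℝ) * (q ^ ((1 / 2 : ℝ) * d) * (2 * q ^ (1 / 2 : ℝ))) =
        2 * (q ^ (-1 : ℝ) * (q ^ ((1 / 2 : ℝ) * d) * q ^ (1 / 2 : ℝ))) by ring]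
      rw [← Real.rpow_add hq0, ← Real.rpow_add hq0]
      congr 2; ring

lemma orth {F : Type} [Field F] [Fintype F] [DecidableEq F] {d : ℕ} (ψ : AddChar F ℂ)
    (hψ : ψ.IsPrimitive) (z : Fin d → F) :
    ∑ m : Fin d → F, ψ (∑ j, m j * z j) = if z = 0 then (Fintype.card F : ℂ) ^ d else 0 := by
  simp only [ψ_sum]
  rw [prod_sum_ψ (fun j a => ψ (a * z j))]
  simp only [mul_comm _ (z _), sum_ψ ψ hψ]
  split_ifs with h
  · subst h; simp
  · obtain ⟨i, hi⟩ := Function.ne_iff.1 h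
    exact Finset.prod_eq_zero (Finset.mem_univ i) (if_neg hi)

lemma parseval {F : Type} [Field F] [Fintype F] [DecidableEq F] {d : ℕ} (ψ : AddChar F ℂ)
    (hψ : ψ.IsPrimitive) (f : (Fin d → F) → ℝ) :
    ∑ m : Fin d → F, ‖∑ x, (f x : ℂ) * ψ (∑ j, m j * x j)‖ ^ 2 = (Fintype.card F : ℝ) ^ d * ∑ x, f x ^ 2 := by
  have : ((∑ m : Fin d → F, ‖∑ x, (f x : ℂ) * ψ (∑ j, m j * x j)‖ ^ 2 : ℝ) : ℂ) =
      (((Fintype.card F : ℝ) ^ d * ∑ x, f x ^ 2 : ℝ) : ℂ) := by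
    push_cast
    have e : ∀ m : Fin d → F, (‖∑ x, (f x : ℂ) * ψ (∑ j, m j * x j)‖ : ℂ) ^ 2 =
        ∑ x, ∑ y, (f x : ℂ) * (f y : ℂ) * ψ (∑ j, m j * (x - y) j) := by
      intro m
      rw [← Complex.mul_conj', map_sum, Finset.sum_mul_sum]
      refine Finset.sum_congr rfl fun x _ => Finset.sum_congr rfl fun y _ => ?_
      rw [map_mul, Complex.conj_ofReal, ← AddChar.map_neg_eq_conj]
      simp only [Pi.sub_apply, mul_sub, Finset.sum_sub_distrib]
      rw [sub_eq_add_neg, AddChar.map_add_eq_mul]; ring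
    simp only [e]
    rw [Finset.sum_comm, Finset.mul_sum]
    refine Finset.sum_congr rfl fun x _ => ?_
    rw [Finset.sum_comm]
    simp only [← Finset.mul_sum, orth ψ hψ, sub_eq_zero]
    simp; ring
  exact_mod_cast this

lemma bilinear {F : Type} [Field F] [Fintype F] [DecidableEq F] {d : ℕ} (ψ : AddChar F ℂ)
    (hψ : ψ.IsPrimitive) (h : (Fin d → F) → ℂ) (B : ℝ)
    (hB : ∀ m : Fin d → F, ‖∑ z : Fin d → F, h z * ψ (∑ j, m j * z j)‖ ≤ B) (f g : (Fin d → F) → ℝ) :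
    ‖∑ x, ∑ y, (f x : ℂ) * h (x - y) * (g y : ℂ)‖ ≤ B * Real.sqrt ((∑ x, f x ^ 2) * ∑ x, g x ^ 2) := by
  set Q : ℝ := (Fintype.card F : ℝ) ^ d with hQ
  have hQ0 : 0 < Q := by
    have : (0 : ℝ) < Fintype.card F := by exact_mod_cast Fintype.card_pos
    positivity
  have hB0 : 0 ≤ B := (norm_nonneg _).trans (hB 0)
  set fh : (Fin d → F) → ℂ := fun m => ∑ x, (f x : ℂ) * ψ (∑ j, m j * x j) with hfh
  set gh : (Fin d → F) → ℂ := fun m => ∑ x, (g x : ℂ) * ψ (∑ j, m j * x j) with hgh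
  set hh : (Fin d → F) → ℂ := fun m => ∑ z, h z * ψ (∑ j, m j * z j) with hhh
  have key : (Q : ℂ) * ∑ x, ∑ y, (f x : ℂ) * h (x - y) * (g y : ℂ) =
      ∑ m, hh m * ((starRingEnd ℂ) (fh m) * gh m) := by
    have e1 : ∀ w : Fin d → F, (Q : ℂ) * h w = ∑ m : Fin d → F, hh m * ψ (-∑ j, m j * w j) := by
      intro w
      simp only [hhh, Finset.sum_mul]
      rw [Finset.sum_comm]
      have : ∀ z : Fin d → F, ∑ m : Fin d → F, h z * ψ (∑ j, m j * z j) * ψ (-∑ j, m j * w j) =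
          h z * if z = w then (Fintype.card F : ℂ) ^ d else 0 := by
        intro z
        have := orth ψ hψ (z - w)
        simp only [sub_eq_zero] at this
        rw [← this, Finset.mul_sum]
        refine Finset.sum_congr rfl fun m _ => ?_
        rw [mul_assoc, ← AddChar.map_add_eq_mul]
        simp only [Pi.sub_apply, mul_sub, Finset.sum_sub_distrib]
        rw [sub_eq_add_neg]
      rw [Finset.sum_congr rfl fun z _ => this z]
      simp [hQ, mul_comm]
    have e2 : ∀ m, hh m * ((starRingEnd ℂ) (fh m) * gh m) = ∑ x, ∑ y, (f x : ℂ) * (hh m * ψ (-∑ j, m j * (x - y) j)) * (g y : ℂ) := by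
      intro m
      rw [hfh, hgh, map_sum, Finset.sum_mul_sum, Finset.mul_sum]
      refine Finset.sum_congr rfl fun x _ => ?_
      rw [Finset.mul_sum]
      refine Finset.sum_congr rfl fun y _ => ?_
      rw [map_mul, Complex.conj_ofReal, ← AddChar.map_neg_eq_conj]
      simp only [Pi.sub_apply, mul_sub, Finset.sum_sub_distrib]
      rw [neg_sub, sub_eq_add_neg, AddChar.map_add_eq_mul]; ring
    simp only [e2]
    rw [Finset.mul_sum, Finset.sum_comm]
    refine Finset.sum_congr rfl fun x _ => ?_
    rw [Finset.mul_sum, Finset.sum_comm]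
    refine Finset.sum_congr rfl fun y _ => ?_
    rw [← Finset.sum_mul, ← Finset.mul_sum, ← e1]; ring
  have h1 : Q * ‖∑ x, ∑ y, (f x : ℂ) * h (x - y) * (g y : ℂ)‖ ≤ B * ∑ m, ‖fh m‖ * ‖gh m‖ := by
    have : Q * ‖∑ x, ∑ y, (f x : ℂ) * h (x - y) * (g y : ℂ)‖ = ‖(Q : ℂ) * ∑ x, ∑ y, (f x : ℂ) * h (x - y) * (g y : ℂ)‖ := by
      rw [norm_mul, Complex.norm_real, Real.norm_of_nonneg hQ0.le]
    rw [this, key, Finset.mul_sum]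
    refine (norm_sum_le _ _).trans (Finset.sum_le_sum fun m _ => ?_)
    rw [norm_mul, norm_mul, RCLike.norm_conj]
    exact mul_le_mul_of_nonneg_right (hB m) (by positivity)
  have h2 : ∑ m, ‖fh m‖ * ‖gh m‖ ≤ Q * Real.sqrt ((∑ x, f x ^ 2) * ∑ x, g x ^ 2) := by
    refine (Real.sum_mul_le_sqrt_mul_sqrt _ _ _).trans (le_of_eq ?_)
    rw [parseval ψ hψ f, parseval ψ hψ g, ← Real.sqrt_mul (by positivity)]
    rw [show Q * (∑ x, f x ^ 2) * (Q * ∑ x, g x ^ 2) = Q ^ 2 * ((∑ x, f x ^ 2) * ∑ x, g x ^ 2) by ring,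
      Real.sqrt_mul (by positivity), Real.sqrt_sq hQ0.le]
  refine le_of_mul_le_mul_left ?_ hQ0
  calc _ ≤ _ := h1
    _ ≤ B * (Q * Real.sqrt ((∑ x, f x ^ 2) * ∑ x, g x ^ 2)) := mul_le_mul_of_nonneg_left h2 hB0
    _ = _ := by ring

/-- number of chains of length `n` starting at `x` -/
def fch {F : Type} [Field F] [Fintype F] [DecidableEq F] {d : ℕ}
    (E : Finset (Fin d → F)) : ℕ → (Fin d → F) → ℕ
  | 0, x => if x ∈ E then 1 else 0
  | n + 1, x => if x ∈ E then ∑ y : Fin d → F, (if ∑ j, (x j - y j) ^ 2 = 1 then 1 else 0) * fch E n y else 0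

lemma chain_sum {F : Type} [Field F] [Fintype F] [DecidableEq F] {d : ℕ}
    (E : Finset (Fin d → F)) (n : ℕ) : ∀ φ : (Fin d → F) → ℕ,
    ∑ x : Fin (n + 1) → (Fin d → F), (if (∀ i, x i ∈ E) ∧
      ∀ i : Fin n, ∑ j, (x i.castSucc j - x i.succ j) ^ 2 = 1 then φ (x 0) else 0) =
    ∑ v, φ v * fch E n v := by
  induction n with
  | zero =>
    intro φ
    rw [← Equiv.sum_comp (Equiv.funUnique (Fin 1) (Fin d → F)).symm]
    refine Finset.sum_congr rfl fun v _ => ?_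
    simp [fch]
  | succ n ih =>
    intro φ
    rw [← Equiv.sum_comp (Fin.consEquiv (fun _ : Fin (n + 2) => (Fin d → F))), Fintype.sum_prod_type]
    refine Finset.sum_congr rfl fun v _ => ?_
    by_cases hv : v ∈ E
    · have h := ih (fun u => φ v * (if ∑ j, (v j - u j) ^ 2 = 1 then 1 else 0))
      rw [fch, if_pos hv, Finset.mul_sum]
      simp only [← mul_assoc]
      rw [← h]
      refine Finset.sum_congr rfl fun x _ => ?_
      simp only [Fin.consEquiv_apply, Fin.forall_fin_succ (n := n + 1), Fin.cons_zero, Fin.cons_succ]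
      have hc : (∀ i : Fin (n + 1), ∑ j, ((Fin.cons v x : Fin (n + 2) → (Fin d → F)) i.castSucc j - x i j) ^ 2 = 1) ↔
          (∑ j, (v j - x 0 j) ^ 2 = 1) ∧ ∀ i : Fin n, ∑ j, (x i.castSucc j - x i.succ j) ^ 2 = 1 := by
        rw [Fin.forall_fin_succ]
        simp only [Fin.castSucc_zero, Fin.cons_zero, ← Fin.succ_castSucc, Fin.cons_succ]
      by_cases h1 : ∀ i, x i ∈ E <;> by_cases h2 : ∑ j, (v j - x 0 j) ^ 2 = 1 <;>
        by_cases h3 : ∀ i : Fin n, ∑ j, (x i.castSucc j - x i.succ j) ^ 2 = 1 <;>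
        simp [hc, hv, h1, h2, h3]
    · rw [fch, if_neg hv, mul_zero]
      refine Finset.sum_eq_zero fun x _ => ?_
      rw [if_neg]
      rintro ⟨h, _⟩
      exact hv (by simpa using h 0)

lemma chainCount_eq {F : Type} [Field F] [Fintype F] [DecidableEq F] {d : ℕ}
    (E : Finset (Fin d → F)) (n : ℕ) : chainCount E n = ∑ v, fch E n v := by
  have := chain_sum E n (fun _ => 1)
  simp only [one_mul] at this
  rw [← this, chainCount, Finset.card_filter]

lemma fch_notMem {F : Type} [Field F] [Fintype F] [DecidableEq F] {d : ℕ}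
    (E : Finset (Fin d → F)) (n : ℕ) (x : Fin d → F) (hx : x ∉ E) : fch E n x = 0 := by
  cases n <;> simp [fch, hx]

lemma fch_mul_succ {F : Type} [Field F] [Fintype F] [DecidableEq F] {d : ℕ}
    (E : Finset (Fin d → F)) (a b : ℕ) (x : Fin d → F) : fch E a x * fch E (b + 1) x =
      ∑ y, fch E a x * ((if ∑ j, (x j - y j) ^ 2 = 1 then 1 else 0) * fch E b y) := by
  by_cases hx : x ∈ E
  · rw [fch, if_pos hx, Finset.mul_sum]
  · simp [fch_notMem E _ x hx]

lemma fch_inner {F : Type} [Field F] [Fintype F] [DecidableEq F] {d : ℕ}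
    (E : Finset (Fin d → F)) (a : ℕ) : ∀ b : ℕ, ∑ x, fch E a x * fch E b x = chainCount E (a + b) := by
  induction a with
  | zero =>
    intro b
    rw [chainCount_eq, zero_add]
    refine Finset.sum_congr rfl fun x _ => ?_
    by_cases hx : x ∈ E
    · simp [fch, hx]
    · simp [fch_notMem E _ x hx]
  | succ a ih =>
    intro b
    rw [show a + 1 + b = a + (b + 1) by ring, ← ih (b + 1)]
    simp only [mul_comm (fch E (a + 1) _), fch_mul_succ]
    rw [Finset.sum_comm]
    refine Finset.sum_congr rfl fun x _ => Finset.sum_congr rfl fun y _ => ?_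
    have : ∑ j, (y j - x j) ^ 2 = ∑ j, (x j - y j) ^ 2 := Finset.sum_congr rfl fun j _ => by ring
    rw [this]; ring

lemma exists_primitive (F : Type) [Field F] [Fintype F] : ∃ ψ : AddChar F ℂ, ψ.IsPrimitive := by
  obtain ⟨ψ, h⟩ := (AddChar.exists_apply_ne_zero (α := F) (a := 1)).2 one_ne_zero
  exact ⟨ψ, AddChar.IsPrimitive.of_ne_one (AddChar.ne_one_iff.2 ⟨1, h⟩)⟩

theorem statement8 {F : Type} [Field F] [Fintype F] [DecidableEq F]
    (q : ℕ) (hq : Fintype.card F = q) (hodd : Odd q)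
    (d : ℕ) (hd : 2 ≤ d)
    (E : Finset (Fin d → F)) (k : ℕ) (hk : 1 ≤ k) :
    ∃ R : ℝ,
      (chainCount E (2 * k) : ℝ) =
        (q : ℝ)⁻¹ * (chainCount E k : ℝ) * (chainCount E (k - 1) : ℝ) + R ∧
      |R| ≤ 2 * (q : ℝ) ^ (((d : ℝ) - 1) / 2) *
        Real.sqrt ((chainCount E (2 * k) : ℝ) * (chainCount E (2 * k - 2) : ℝ)) := by
  subst hq
  obtain ⟨n, rfl⟩ : ∃ n, k = n + 1 := ⟨k - 1, by omega⟩
  obtain ⟨ψ, hψ⟩ := exists_primitive F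
  have hb := bilinear ψ hψ hfun _ (hhat_bound (d := d) hodd ψ hψ)
    (fun x => (fch E (n + 1) x : ℝ)) (fun x => (fch E n x : ℝ))
  have e1 : ∑ x, (fch E (n + 1) x : ℝ) ^ 2 = chainCount E (2 * (n + 1)) := by
    rw [two_mul, ← fch_inner]; push_cast
    exact Finset.sum_congr rfl fun x _ => by ring
  have e2 : ∑ x, (fch E n x : ℝ) ^ 2 = chainCount E (2 * (n + 1) - 2) := by
    rw [show 2 * (n + 1) - 2 = n + n by omega, ← fch_inner]; push_cast
    exact Finset.sum_congr rfl fun x _ => by ring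
  rw [e1, e2] at hb
  have e3 : ∑ x, ∑ y, ((fch E (n + 1) x : ℝ) : ℂ) * hfun (x - y) * ((fch E n y : ℝ) : ℂ) =
      (((chainCount E (2 * (n + 1)) : ℝ) - (Fintype.card F : ℝ)⁻¹ * (chainCount E (n + 1) : ℝ) * (chainCount E n : ℝ) : ℝ) : ℂ) := by
    have e4 : (chainCount E (2 * (n + 1)) : ℂ) = ∑ x, ∑ y, (fch E (n + 1) x : ℂ) *
        ((if ∑ j, (x j - y j) ^ 2 = 1 then 1 else 0) * (fch E n y : ℂ)) := by
      rw [two_mul, ← fch_inner]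
      simp only [fch_mul_succ E (n + 1) n]
      push_cast
      rfl
    have e5 : (chainCount E (n + 1) : ℂ) * (chainCount E n : ℂ) = ∑ x, ∑ y, (fch E (n + 1) x : ℂ) * (fch E n y : ℂ) := by
      rw [chainCount_eq, chainCount_eq]; push_cast
      rw [Finset.sum_mul_sum]
    push_cast
    rw [e4, mul_assoc, e5, Finset.mul_sum, ← Finset.sum_sub_distrib]
    refine Finset.sum_congr rfl fun x _ => ?_
    rw [Finset.mul_sum, ← Finset.sum_sub_distrib]
    refine Finset.sum_congr rfl fun y _ => ?_
    simp only [hfun, Pi.sub_apply]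
    ring
  rw [e3, Complex.norm_real, Real.norm_eq_abs] at hb
  refine ⟨_, ?_, hb⟩
  rw [Nat.add_sub_cancel]; ring
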